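/- arXiv:math/0610988 — 3 statements merged into one kernel-verified Lean document; each statement's English description precedes it below -/
import Mathlib

section
/- Let E be a countable Borel equivalence relation on a Polish space X (every E-class is countable). Then: (i) E is the orbit equivalence relation of a Borel action of a countable group: there exist a countable group G and a map a : G → X → X such that each a(g) : X → X is Borel-measurable, a(1) is the identity, a(g) ∘ a(h) = a(g·h) for all g, h ∈ G, and for all x, y ∈ X: x E y ↔ ∃ g ∈ G, a(g)(x) = y; (ii) E is Borel reducible to E∞ = E(F₂, 2). -/
open MeasureTheory

/-- Borel reducibility: a Borel-measurable map `θ` with `E x x' ↔ F (θ x) (θ x')`. -/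
def BorelReducible {X Y : Type*} [TopologicalSpace X] [TopologicalSpace Y]
    (E : X → X → Prop) (F : Y → Y → Prop) : Prop :=
  ∃ θ : X → Y, @Measurable X Y (borel X) (borel Y) θ ∧
    ∀ x x' : X, E x x' ↔ F (θ x) (θ x')

/-- `E∞ = E(F₂,2)`: the orbit equivalence relation of the shift action of the free
group on two generators on `2^{F₂}`: `x ∼ y` iff `y = w · x` for some `w ∈ F₂`,
where `(w · x)(u) = x(w⁻¹ · u)`. -/
def Einf (x y : FreeGroup Bool → Bool) : Prop :=
  ∃ w : FreeGroup Bool, ∀ u : FreeGroup Bool, y u = x (w⁻¹ * u)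

open Set Filter Topology

theorem analyticSet_inter {α : Type*} [TopologicalSpace α] [T2Space α] {s t : Set α}
    (hs : AnalyticSet s) (ht : AnalyticSet t) : AnalyticSet (s ∩ t) := by
  rw [inter_eq_iInter]
  exact AnalyticSet.iInter fun b => by cases b <;> assumption

section SigmaInjOn

variable {P X : Type*} [MeasurableSpace P] {f : P → X}

/-- A set is `σ`-injective for `f` if it is a countable union of measurable sets on each of which
`f` is injective. -/
def SigmaInjOn (f : P → X) (B : Set P) : Prop :=
  ∃ C : Set (Set P), C.Countable ∧ (∀ c ∈ C, MeasurableSet c ∧ InjOn f c) ∧ ⋃₀ C = B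

theorem SigmaInjOn.measurableSet {B : Set P} (h : SigmaInjOn f B) : MeasurableSet B := by
  obtain ⟨C, hC, hm, rfl⟩ := h
  exact MeasurableSet.sUnion hC fun c hc => (hm c hc).1

theorem SigmaInjOn.biUnion {ι : Type*} {t : Set ι} (ht : t.Countable) {B : ι → Set P}
    (h : ∀ i ∈ t, SigmaInjOn f (B i)) : SigmaInjOn f (⋃ i ∈ t, B i) := by
  choose! C hC hm hU using h
  refine ⟨⋃ i ∈ t, C i, ht.biUnion hC, ?_, ?_⟩
  · intro c hc
    obtain ⟨i, hi, hc⟩ := mem_iUnion₂.1 hc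
    exact hm i hi c hc
  · simp only [sUnion_iUnion]
    exact iUnion₂_congr hU

theorem SigmaInjOn.union_of_injOn {B c : Set P} (hB : SigmaInjOn f B) (hc : MeasurableSet c)
    (hi : InjOn f c) : SigmaInjOn f (c ∪ B) := by
  obtain ⟨C, hC, hm, rfl⟩ := hB
  refine ⟨insert c C, hC.insert c, ?_, sUnion_insert c C⟩
  rintro d (rfl | hd)
  · exact ⟨hc, hi⟩
  · exact hm d hd

/-- A set of sequences is large if it cannot be covered by requiring some coordinate to lie in a
fixed `σ`-injective set. -/
def LargeSeqs (f : P → X) (H : Set (ℕ → P)) : Prop :=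
  ∀ B, SigmaInjOn f B → ∃ φ ∈ H, ∀ j, φ j ∉ B

theorem LargeSeqs.exists_of_subset_biUnion {H : Set (ℕ → P)} (hH : LargeSeqs f H) {ι : Type*}
    {t : Set ι} (ht : t.Countable) {V : ι → Set (ℕ → P)} (hV : H ⊆ ⋃ i ∈ t, V i) :
    ∃ i ∈ t, LargeSeqs f (H ∩ V i) := by
  by_contra! hcon
  have h : ∀ i ∈ t, ∃ B, SigmaInjOn f B ∧ ∀ φ ∈ H ∩ V i, ∃ j, φ j ∈ B := by
    intro i hi
    have := hcon i hi
    simp only [LargeSeqs] at this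
    push Not at this
    exact this
  choose! B hB hBV using h
  obtain ⟨φ, hφ, hφB⟩ := hH _ (SigmaInjOn.biUnion ht hB)
  obtain ⟨i, hi, hiV⟩ := mem_iUnion₂.1 (hV hφ)
  obtain ⟨j, hj⟩ := hBV i hi φ ⟨hφ, hiV⟩
  exact hφB j (mem_iUnion₂.2 ⟨i, hi, hj⟩)

end SigmaInjOn

section CountableToOne

variable {P X : Type*} [MetricSpace P] [CompleteSpace P] [SecondCountableTopology P]
  [MeasurableSpace P] [BorelSpace P] [TopologicalSpace X] [T2Space X] {f : P → X}

/-- The points of distinct pairs on which `f` agrees form an analytic set. -/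
theorem analyticSet_eq_and_ne (hf : Continuous f) :
    AnalyticSet {p : P × P | f p.1 = f p.2 ∧ p.1 ≠ p.2} := by
  have h1 : IsClosed {p : P × P | f p.1 = f p.2} :=
    isClosed_eq (hf.comp continuous_fst) (hf.comp continuous_snd)
  have h2 : IsOpen {p : P × P | p.1 ≠ p.2} := isOpen_ne_fun continuous_fst continuous_snd
  exact (h1.measurableSet.inter h2.measurableSet).analyticSet

theorem MeasureTheory.AnalyticSet.exists_measurableSet_injOn (hf : Continuous f) {A : Set P}
    (hA : AnalyticSet A) (hi : InjOn f A) : ∃ B, A ⊆ B ∧ MeasurableSet B ∧ InjOn f B := by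
  let N : Set P → Set P := fun A =>
    Prod.fst '' ({p : P × P | f p.1 = f p.2 ∧ p.1 ≠ p.2} ∩ Prod.snd ⁻¹' A)
  have hN : ∀ A, AnalyticSet A → AnalyticSet (N A) := fun A hA =>
    (analyticSet_inter (analyticSet_eq_and_ne hf)
      (hA.preimage continuous_snd)).image_of_continuous continuous_fst
  have hdisj : Disjoint (N A) A := by
    rw [Set.disjoint_left]
    rintro _ ⟨⟨p, q⟩, ⟨⟨h1, h2⟩, hq⟩, rfl⟩ hp
    exact h2 (hi hp hq h1)
  obtain ⟨C, hNC, hCA, hC⟩ := (hN A hA).measurablySeparable hA hdisj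
  have hdisj' : Disjoint (N Cᶜ) A := by
    rw [Set.disjoint_left]
    rintro _ ⟨⟨p, q⟩, ⟨⟨h1, h2⟩, hq⟩, rfl⟩ hp
    exact hq (hNC ⟨(q, p), ⟨⟨h1.symm, h2.symm⟩, hp⟩, rfl⟩)
  obtain ⟨D, hND, hDA, hD⟩ := (hN _ hC.compl.analyticSet).measurablySeparable hA hdisj'
  refine ⟨Cᶜ ∩ Dᶜ, ?_, hC.compl.inter hD.compl, ?_⟩
  · exact subset_inter (subset_compl_iff_disjoint_right.2 hCA.symm.symm)
      (subset_compl_iff_disjoint_right.2 hDA.symm.symm)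
  · rintro p ⟨-, hpD⟩ q ⟨hqC, -⟩ hpq
    by_contra hne
    exact hpD (hND ⟨(p, q), ⟨⟨hpq, hne⟩, hqC⟩, rfl⟩)

/-- Sequences obtained from two members of `H` lying in the same fibre and differing at
coordinate `k`, by putting the `k`-th coordinate of the second one in place `n` of the first. -/
def splitSeqs (f : P → X) (H : Set (ℕ → P)) (k n : ℕ) : Set (ℕ → P) :=
  (fun p : (ℕ → P) × (ℕ → P) => Function.update p.1 n (p.2 k)) ''
    {p | (p.1 ∈ H ∧ p.2 ∈ H) ∧ f (p.1 k) = f (p.2 k) ∧ p.1 k ≠ p.2 k}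

theorem analyticSet_splitSeqs (hf : Continuous f) {H : Set (ℕ → P)} (hH : AnalyticSet H)
    (k n : ℕ) : AnalyticSet (splitSeqs f H k n) := by
  refine AnalyticSet.image_of_continuous (analyticSet_inter (analyticSet_inter
    (hH.preimage continuous_fst) (hH.preimage continuous_snd)) ?_) (by fun_prop)
  exact (analyticSet_eq_and_ne hf).preimage
    (f := fun p : (ℕ → P) × (ℕ → P) => (p.1 k, p.2 k)) (by fun_prop)

theorem LargeSeqs.splitSeqs (hf : Continuous f) {H : Set (ℕ → P)} (hH : AnalyticSet H)
    (hL : LargeSeqs f H) (k n : ℕ) : LargeSeqs f (splitSeqs f H k n) := by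
  intro B hB
  have hA : AnalyticSet (H ∩ {φ | ∀ j, φ j ∉ B}) := by
    refine analyticSet_inter hH (MeasurableSet.analyticSet ?_)
    simp only [ofPred_forall]
    exact MeasurableSet.iInter fun j =>
      hB.measurableSet.compl.preimage (measurable_pi_apply (X := fun _ => P) j)
  have hni : ¬ InjOn f ((fun φ : ℕ → P => φ k) '' (H ∩ {φ | ∀ j, φ j ∉ B})) := by
    intro hi
    obtain ⟨B', hAB', hB', hi'⟩ :=
      (hA.image_of_continuous (continuous_apply k)).exists_measurableSet_injOn hf hi
    obtain ⟨φ, hφ, hφB⟩ := hL _ (hB.union_of_injOn hB' hi')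
    exact hφB k (Or.inl (hAB' ⟨φ, ⟨hφ, fun j hj => hφB j (Or.inr hj)⟩, rfl⟩))
  simp only [InjOn] at hni
  push Not at hni
  obtain ⟨_, ⟨φ, ⟨hφ, hφB⟩, rfl⟩, _, ⟨ψ, ⟨hψ, hψB⟩, rfl⟩, he, hne⟩ := hni
  refine ⟨_, ⟨(φ, ψ), ⟨⟨hφ, hψ⟩, he, hne⟩, rfl⟩, fun j => ?_⟩
  by_cases hj : j = n
  · subst hj
    simpa using hψB k
  · simpa [hj] using hφB j

theorem LargeSeqs.exists_next (hf : Continuous f) {H : Set (ℕ → P)} (hH : AnalyticSet H)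
    (hL : LargeSeqs f H) (hc : ∀ φ ∈ H, ∀ i j, f (φ i) = f (φ j)) {k n : ℕ} (hk : k ≤ n)
    {δ : ℝ} (hδ : 0 < δ) :
    ∃ H' : Set (ℕ → P), (AnalyticSet H' ∧ LargeSeqs f H' ∧ ∀ φ ∈ H', ∀ i j, f (φ i) = f (φ j)) ∧
      (∀ φ ∈ H', ∃ χ ∈ H, ∀ j ≤ n, φ j = χ j) ∧ (∀ φ ∈ H', ∃ ψ ∈ H, φ (n + 1) = ψ k) ∧
      (∃ ε > 0, ∀ φ ∈ H', ε ≤ dist (φ k) (φ (n + 1))) ∧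
      ∀ φ ∈ H', ∀ ψ ∈ H', ∀ j ≤ n + 1, dist (φ j) (ψ j) ≤ δ := by
  let V : (ℕ → P) → Set (ℕ → P) := fun φ =>
    (⋂ j ∈ Finset.range (n + 2), {ψ | dist (ψ j) (φ j) < δ / 2}) ∩
      {ψ | dist (φ k) (φ (n + 1)) / 2 < dist (ψ k) (ψ (n + 1))}
  have hVo : ∀ φ, IsOpen (V φ) := fun φ =>
    (isOpen_biInter_finset fun j _ => isOpen_lt (by fun_prop) (by fun_prop)).inter
      (isOpen_lt (by fun_prop) (by fun_prop))
  have hpos : ∀ φ ∈ _root_.splitSeqs f H k (n + 1), 0 < dist (φ k) (φ (n + 1)) := by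
    rintro _ ⟨⟨φ, ψ⟩, ⟨-, -, hne⟩, rfl⟩
    have : k ≠ n + 1 := by lia
    simpa [this] using hne
  have hV : ∀ φ ∈ _root_.splitSeqs f H k (n + 1), V φ ∈ 𝓝[_root_.splitSeqs f H k (n + 1)] φ := by
    intro φ hφ
    refine mem_nhdsWithin_of_mem_nhds ((hVo φ).mem_nhds ⟨?_, ?_⟩)
    · simp only [mem_iInter, mem_ofPred_eq, dist_self]
      intros
      positivity
    · exact half_lt_self (hpos φ hφ)
  obtain ⟨t, htH, ht, hcov⟩ := TopologicalSpace.countable_cover_nhdsWithin hV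
  obtain ⟨φ₀, hφ₀, hlarge⟩ := (hL.splitSeqs hf hH k (n + 1)).exists_of_subset_biUnion ht hcov
  refine ⟨_, ⟨analyticSet_inter (analyticSet_splitSeqs hf hH k (n + 1))
    (hVo φ₀).measurableSet.analyticSet, hlarge, ?_⟩, ?_, ?_,
    ⟨_, half_pos (hpos φ₀ (htH hφ₀)), ?_⟩, ?_⟩
  · rintro _ ⟨⟨⟨φ, ψ⟩, ⟨⟨hφ, hψ⟩, he, -⟩, rfl⟩, -⟩
    have key : ∀ i, f (Function.update φ (n + 1) (ψ k) i) = f (φ k) := by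
      intro i
      by_cases hi : i = n + 1
      · subst hi
        simpa using he.symm
      · simpa [hi] using hc φ hφ i k
    intro i j
    exact (key i).trans (key j).symm
  · rintro _ ⟨⟨⟨φ, ψ⟩, ⟨⟨hφ, hψ⟩, -⟩, rfl⟩, -⟩
    refine ⟨φ, hφ, fun j hj => ?_⟩
    have : j ≠ n + 1 := by lia
    simp [this]
  · rintro _ ⟨⟨⟨φ, ψ⟩, ⟨⟨hφ, hψ⟩, -⟩, rfl⟩, -⟩
    exact ⟨ψ, hψ, by simp⟩
  · rintro φ ⟨-, -, hφ⟩
    exact hφ.le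
  · rintro φ ⟨-, hφ, -⟩ ψ ⟨-, hψ, -⟩ j hj
    have h1 : dist (φ j) (φ₀ j) < δ / 2 := mem_iInter₂.1 hφ j (Finset.mem_range.2 (by lia))
    have h2 : dist (ψ j) (φ₀ j) < δ / 2 := mem_iInter₂.1 hψ j (Finset.mem_range.2 (by lia))
    linarith [dist_triangle_right (φ j) (ψ j) (φ₀ j)]

/-- A continuous countable-to-one map on a Polish space is injective on each member of some
countable Borel cover. -/
theorem sigmaInjOn_univ_of_continuous (hf : Continuous f)
    (hcount : ∀ x, (f ⁻¹' {x}).Countable) : SigmaInjOn f univ := by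
  by_contra hn
  let State := {H : Set (ℕ → P) //
    AnalyticSet H ∧ LargeSeqs f H ∧ ∀ φ ∈ H, ∀ i j, f (φ i) = f (φ j)}
  have hstart : LargeSeqs f (range fun (p : P) (_ : ℕ) => p) := by
    intro B hB
    obtain ⟨p, hp⟩ : ∃ p, p ∉ B := by
      by_contra! h
      exact hn (eq_univ_of_forall h ▸ hB)
    exact ⟨_, ⟨p, rfl⟩, fun _ => hp⟩
  let s₀ : State := ⟨range fun (p : P) (_ : ℕ) => p,
    analyticSet_range_of_polishSpace (by fun_prop), hstart, by rintro _ ⟨p, rfl⟩ i j; rfl⟩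
  have hnext : ∀ (n : ℕ) (s : State), ∃ s' : State,
      (∀ φ ∈ s'.1, ∃ χ ∈ s.1, ∀ j ≤ n, φ j = χ j) ∧
      (∀ φ ∈ s'.1, ∃ ψ ∈ s.1, φ (n + 1) = ψ n.unpair.1) ∧
      (∃ ε > 0, ∀ φ ∈ s'.1, ε ≤ dist (φ n.unpair.1) (φ (n + 1))) ∧
      ∀ φ ∈ s'.1, ∀ ψ ∈ s'.1, ∀ j ≤ n + 1, dist (φ j) (ψ j) ≤ (1 / 2 : ℝ) ^ n := by
    rintro n ⟨H, hH, hL, hc⟩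
    obtain ⟨H', h, h'⟩ := hL.exists_next hf hH hc n.unpair_left_le
      (δ := (1 / 2 : ℝ) ^ n) (by positivity)
    exact ⟨⟨H', h⟩, h'⟩
  choose next hagree hcopy hsep hdiam using hnext
  let S : ℕ → State := fun n => Nat.rec s₀ next n
  have hagree' : ∀ n m, n ≤ m → ∀ φ ∈ (S m).1, ∃ χ ∈ (S n).1, ∀ j ≤ n, φ j = χ j := by
    intro n m hnm
    induction m, hnm using Nat.le_induction with
    | base => exact fun φ hφ => ⟨φ, hφ, fun _ _ => rfl⟩
    | succ m hm ih =>
      intro φ hφ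
      obtain ⟨χ, hχ, h1⟩ := hagree m (S m) φ hφ
      obtain ⟨χ', hχ', h2⟩ := ih χ hχ
      exact ⟨χ', hχ', fun j hj => (h1 j (hj.trans hm)).trans (h2 j hj)⟩
  have hne : ∀ n, ∃ φ, φ ∈ (S n).1 := fun n => by
    obtain ⟨φ, hφ, -⟩ := (S n).2.2.1 ∅ ⟨∅, countable_empty, by simp, by simp⟩
    exact ⟨φ, hφ⟩
  choose φ hφ using hne
  have hcauchy : ∀ j, CauchySeq fun n => φ n j := by
    intro j
    refine Metric.cauchySeq_iff'.2 fun ε hε => ?_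
    obtain ⟨M, hM⟩ := exists_pow_lt_of_lt_one hε (by norm_num : (1 / 2 : ℝ) < 1)
    refine ⟨max j M + 1, fun m hm => ?_⟩
    obtain ⟨χ, hχ, h⟩ := hagree' _ m hm (φ m) (hφ m)
    rw [h j (by lia)]
    refine lt_of_le_of_lt (hdiam (max j M) (S (max j M)) χ hχ _ (hφ (max j M + 1)) j (by lia)) ?_
    exact lt_of_le_of_lt (pow_le_pow_of_le_one (by norm_num) (by norm_num) (le_max_right j M)) hM
  choose p hp using fun j => cauchySeq_tendsto_of_complete (hcauchy j)
  have hfib : ∀ j, f (p j) = f (p 0) := fun j => by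
    refine tendsto_nhds_unique ((hf.tendsto _).comp (hp j)) ?_
    refine ((hf.tendsto _).comp (hp 0)).congr fun n => (S n).2.2.2 _ (hφ n) 0 j
  have hpne : ∀ n, p n.unpair.1 ≠ p (n + 1) := fun n => by
    obtain ⟨ε, hε, h⟩ := hsep n (S n)
    have : ε ≤ dist (p n.unpair.1) (p (n + 1)) := by
      refine ge_of_tendsto ((hp _).dist (hp _)) ?_
      filter_upwards [eventually_ge_atTop (n + 1)] with m hm
      obtain ⟨χ, hχ, h'⟩ := hagree' _ m hm (φ m) (hφ m)
      rw [h' _ (n.unpair_left_le.trans n.le_succ), h' _ le_rfl]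
      exact h χ hχ
    exact dist_pos.1 (hε.trans_le this)
  have hpdist : ∀ n, dist (p (n + 1 + 1)) (p (n + 1).unpair.1) ≤ (1 / 2 : ℝ) ^ n := fun n => by
    refine le_of_tendsto ((hp _).dist (hp _)) ?_
    filter_upwards [eventually_ge_atTop (n + 1 + 1)] with m hm
    obtain ⟨χ, hχ, h⟩ := hagree' _ m hm (φ m) (hφ m)
    obtain ⟨χ', hχ', h'⟩ := hagree (n + 1) (S (n + 1)) χ hχ
    obtain ⟨ψ, hψ, h''⟩ := hcopy (n + 1) (S (n + 1)) χ hχ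
    have hk := (n + 1).unpair_left_le
    rw [h _ (hk.trans (Nat.le_succ _)), h _ le_rfl, h'', h' _ hk]
    exact hdiam n (S n) ψ hψ χ' hχ' _ hk
  have hpre : Preperfect (range p) := by
    rw [preperfect_iff_nhds]
    rintro _ ⟨i, rfl⟩ U hU
    obtain ⟨ε, hε, hεU⟩ := Metric.mem_nhds_iff.1 hU
    obtain ⟨M, hM⟩ := exists_pow_lt_of_lt_one hε (by norm_num : (1 / 2 : ℝ) < 1)
    obtain ⟨n, hn⟩ : ∃ n, Nat.pair i (M + 1) = n + 1 :=
      Nat.exists_eq_succ_of_ne_zero (by have := Nat.right_le_pair i (M + 1); lia)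
    have hi : (n + 1).unpair.1 = i := by rw [← hn, Nat.unpair_pair]
    have hMn : M ≤ n := by have := Nat.right_le_pair i (M + 1); lia
    refine ⟨p (n + 1 + 1), ⟨hεU ?_, mem_range_self _⟩, ?_⟩
    · rw [Metric.mem_ball, ← hi]
      exact (hpdist n).trans_lt ((pow_le_pow_of_le_one (by norm_num) (by norm_num) hMn).trans_lt hM)
    · rw [← hi]
      exact (hpne (n + 1)).symm
  obtain ⟨g, hg, -, hginj⟩ := hpre.perfect_closure.exists_nat_bool_injection
    (range_nonempty p).closure
  have hsub : range g ⊆ f ⁻¹' {f (p 0)} := by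
    refine hg.trans (closure_minimal ?_ (isClosed_singleton.preimage hf))
    rintro _ ⟨j, rfl⟩
    exact hfib j
  have hctb : (range g).Countable := (hcount _).mono hsub
  have : Countable (ℕ → Bool) := by
    have := hctb.to_subtype
    exact (rangeFactorization_injective.2 hginj).countable
  obtain ⟨e, he⟩ := exists_surjective_nat (ℕ → Bool)
  obtain ⟨n, hn⟩ := he fun n => !e n n
  simpa using congrFun hn n

end CountableToOne

/-- **Lusin–Novikov**: a Borel countable-to-one map on a standard Borel space is injective on each
member of some countable Borel cover. -/
theorem Measurable.sigmaInjOn_univ {P X : Type*} [MeasurableSpace P] [StandardBorelSpace P]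
    [MeasurableSpace X] [StandardBorelSpace X] {f : P → X} (hf : Measurable f)
    (hcount : ∀ x, (f ⁻¹' {x}).Countable) : SigmaInjOn f univ := by
  let tP := upgradeStandardBorel P
  let := upgradeStandardBorel X
  obtain ⟨t, ht, hft, hPt⟩ := hf.exists_continuous
  have hB : @BorelSpace P t _ := by
    refine @BorelSpace.mk P t _ ?_
    rw [eq_borel_upgradeStandardBorel P,
      borel_eq_borel_of_le hPt (t' := tP.toTopologicalSpace) inferInstance ht]
  let := @TopologicalSpace.upgradeIsCompletelyMetrizable P t _
  exact sigmaInjOn_univ_of_continuous hft hcount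

section FeldmanMoore

variable {X : Type*} [MeasurableSpace X] [StandardBorelSpace X]

/-- **Lusin–Novikov** for subsets of a product: a Borel set with countable sections is a countable
union of graphs of Borel partial functions. -/
theorem MeasurableSet.exists_iUnion_injOn_fst {R : Set (X × X)} (hR : MeasurableSet R)
    (hcount : ∀ x, {y | (x, y) ∈ R}.Countable) :
    ∃ c : ℕ → Set (X × X), (∀ n, MeasurableSet (c n)) ∧ (∀ n, InjOn Prod.fst (c n)) ∧
      ⋃ n, c n = R := by
  have := hR.standardBorel
  obtain ⟨C, hC, hm, hU⟩ := Measurable.sigmaInjOn_univ (P := R) (X := X) (f := fun p => p.1.1)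
    (by fun_prop) (fun x => by
      have : InjOn (fun p : R => p.1.2) ((fun p : R => p.1.1) ⁻¹' {x}) := by
        rintro ⟨⟨a, b⟩, h⟩ ha ⟨⟨a', b'⟩, h'⟩ ha' hb
        obtain rfl : a = x := ha
        obtain rfl : a' = a := ha'
        simpa using hb
      refine countable_of_injective_of_countable_image this ((hcount x).mono ?_)
      rintro _ ⟨⟨⟨a, b⟩, h⟩, ha, rfl⟩
      obtain rfl : a = x := ha
      exact h)
  obtain ⟨c, hc⟩ := (hC.insert ∅).exists_eq_range (insert_nonempty _ _)
  have hmem : ∀ n, c n = ∅ ∨ c n ∈ C := fun n => by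
    have : c n ∈ insert ∅ C := hc ▸ mem_range_self n
    simpa using this
  refine ⟨fun n => Subtype.val '' c n, fun n => ?_, fun n => ?_, ?_⟩
  · refine (MeasurableEmbedding.subtype_coe hR).measurableSet_image.2 ?_
    rcases hmem n with h | h
    · simp [h]
    · exact (hm _ h).1
  · rcases hmem n with h | h
    · simp [h]
    · rintro _ ⟨p, hp, rfl⟩ _ ⟨q, hq, rfl⟩ hpq
      rw [(hm _ h).2 hp hq hpq]
  · ext p
    simp only [mem_iUnion]
    constructor
    · rintro ⟨n, q, -, rfl⟩
      exact q.2
    · intro hp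
      obtain ⟨d, hd, hpd⟩ : (⟨p, hp⟩ : R) ∈ ⋃₀ C := hU ▸ mem_univ _
      obtain ⟨n, rfl⟩ : d ∈ range c := hc ▸ mem_insert_of_mem _ hd
      exact ⟨n, _, hpd, rfl⟩

theorem measurable_of_measurableSet_graph {h : X → X}
    (hh : MeasurableSet {p : X × X | h p.1 = p.2}) : Measurable h := by
  intro s hs
  have : h ⁻¹' s = Prod.fst '' ({p : X × X | h p.1 = p.2} ∩ Prod.snd ⁻¹' s) := by
    ext x
    constructor
    · exact fun hx => ⟨(x, h x), ⟨rfl, hx⟩, rfl⟩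
    · rintro ⟨⟨a, b⟩, ⟨h1, h2⟩, rfl⟩
      obtain rfl : h a = b := h1
      exact h2
  rw [this]
  refine (hh.inter (measurable_snd hs)).image_of_measurable_injOn measurable_fst ?_
  rintro ⟨a, b⟩ ⟨h1, -⟩ ⟨a', b'⟩ ⟨h2, -⟩ (rfl : a = a')
  exact Prod.ext rfl (h1.symm.trans h2)

/-- A symmetric Borel graph of a partial function extends by the identity to a Borel involution. -/
theorem exists_measurable_involutive {R : Set (X × X)} (hR : MeasurableSet R)
    (hinj : InjOn Prod.fst R) (hsymm : ∀ x y, (x, y) ∈ R → (y, x) ∈ R) :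
    ∃ h : X → X, Measurable h ∧ Function.Involutive h ∧ (∀ x y, (x, y) ∈ R → h x = y) ∧
      ∀ x, h x = x ∨ (x, h x) ∈ R := by
  classical
  let h : X → X := fun x => if hx : ∃ y, (x, y) ∈ R then hx.choose else x
  have hpos : ∀ x y, (x, y) ∈ R → h x = y := by
    intro x y hxy
    have hx : ∃ y, (x, y) ∈ R := ⟨y, hxy⟩
    have : h x = hx.choose := dif_pos hx
    rw [this]
    exact congrArg Prod.snd (hinj hx.choose_spec hxy rfl)
  have hneg : ∀ x, (¬ ∃ y, (x, y) ∈ R) → h x = x := fun x hx => dif_neg hx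
  have hcases : ∀ x, h x = x ∨ (x, h x) ∈ R := by
    intro x
    by_cases hx : ∃ y, (x, y) ∈ R
    · obtain ⟨y, hy⟩ := hx
      exact Or.inr (by rwa [hpos x y hy])
    · exact Or.inl (hneg x hx)
  refine ⟨h, measurable_of_measurableSet_graph ?_, ?_, hpos, hcases⟩
  · have hd : MeasurableSet (Prod.fst '' R) := hR.image_of_measurable_injOn measurable_fst hinj
    have : {p : X × X | h p.1 = p.2} = R ∪ (Prod.fst ⁻¹' (Prod.fst '' R)ᶜ ∩ diagonal X) := by
      ext ⟨x, y⟩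
      constructor
      · rintro (rfl : h x = y)
        by_cases hx : ∃ y, (x, y) ∈ R
        · obtain ⟨y, hy⟩ := hx
          exact Or.inl (by rwa [hpos x y hy])
        · refine Or.inr ⟨?_, (hneg x hx).symm⟩
          rintro ⟨⟨a, b⟩, hab, rfl⟩
          exact hx ⟨b, hab⟩
      · rintro (hxy | ⟨hx, hxy⟩)
        · exact hpos x y hxy
        · obtain rfl : x = y := hxy
          exact hneg x fun ⟨y, hy⟩ => hx ⟨_, hy, rfl⟩
    rw [this]
    exact hR.union ((measurable_fst hd.compl).inter measurableSet_diagonal)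
  · intro x
    rcases hcases x with hx | hx
    · rw [hx, hx]
    · exact hpos _ _ (hsymm _ _ hx)

/-- A countable Borel equivalence relation is the union of the graphs of countably many Borel
involutions. -/
theorem exists_involutions_of_countable_equivalence {E : X → X → Prop} (hE : Equivalence E)
    (hBorel : MeasurableSet {p : X × X | E p.1 p.2}) (hctble : ∀ x, {y | E x y}.Countable) :
    ∃ g : ℕ → X → X, (∀ n, Measurable (g n)) ∧ (∀ n, Function.Involutive (g n)) ∧
      (∀ n x, E x (g n x)) ∧ ∀ x y, E x y → x = y ∨ ∃ n, g n x = y := by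
  obtain ⟨c, hcm, hci, hcU⟩ := hBorel.exists_iUnion_injOn_fst hctble
  obtain ⟨ψ, hψ, hψi⟩ := MeasurableSpace.measurable_injection_nat_bool_of_countablySeparated X
  have hcE : ∀ n x y, (x, y) ∈ c n → E x y := fun n x y h => by
    have : (x, y) ∈ {p : X × X | E p.1 p.2} := hcU ▸ mem_iUnion.2 ⟨n, h⟩
    exact this
  let D : ℕ × ℕ × ℕ × Bool → Set (X × X) := fun i =>
    (c i.1 ∩ Prod.swap ⁻¹' c i.2.1) ∩
      {p | ψ p.1 i.2.2.1 = i.2.2.2 ∧ ψ p.2 i.2.2.1 = !i.2.2.2}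
  have hDm : ∀ i, MeasurableSet (D i) := fun i => by
    have hm : ∀ n, Measurable fun x => ψ x n := fun n => (measurable_pi_apply n).comp hψ
    refine ((hcm _).inter (measurable_swap (hcm _))).inter (MeasurableSet.inter ?_ ?_)
    · exact ((hm _).comp measurable_fst) (measurableSet_singleton i.2.2.2)
    · exact ((hm _).comp measurable_snd) (measurableSet_singleton (!i.2.2.2))
  have hinv : ∀ i, ∃ h : X → X, Measurable h ∧ Function.Involutive h ∧
      (∀ x y, (x, y) ∈ D i → h x = y) ∧ ∀ x, E x (h x) := by
    intro i
    have hinj : InjOn Prod.fst (D i ∪ Prod.swap ⁻¹' D i) := by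
      rintro ⟨x, y⟩ hp ⟨x', z⟩ hq (rfl : x = x')
      rcases hp with ⟨⟨hp1, hp2⟩, hp3, hp4⟩ | ⟨⟨hp1, hp2⟩, hp3, hp4⟩ <;>
        rcases hq with ⟨⟨hq1, hq2⟩, hq3, hq4⟩ | ⟨⟨hq1, hq2⟩, hq3, hq4⟩
      · exact hci _ hp1 hq1 rfl
      · simp_all
      · simp_all
      · exact hci _ hp2 hq2 rfl
    obtain ⟨h, hm, hi, h1, h2⟩ := exists_measurable_involutive
      ((hDm i).union (measurable_swap (hDm i))) hinj fun x y h => h.symm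
    refine ⟨h, hm, hi, fun x y hxy => h1 x y (Or.inl hxy), fun x => ?_⟩
    rcases h2 x with hx | hx | hx
    · rw [hx]
      exact hE.refl x
    · exact hcE _ _ _ hx.1.1
    · exact hE.symm (hcE _ _ _ hx.1.1)
  choose h hm hi h1 h2 using hinv
  obtain ⟨e, he⟩ := exists_surjective_nat (ℕ × ℕ × ℕ × Bool)
  refine ⟨fun n => h (e n), fun n => hm _, fun n => hi _, fun n => h2 _, fun x y hxy => ?_⟩
  by_cases hne : x = y
  · exact Or.inl hne
  right
  have hmem : ∀ x y, E x y → ∃ n, (x, y) ∈ c n := fun x y hxy => by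
    have : (x, y) ∈ ⋃ n, c n := hcU ▸ hxy
    simpa using this
  obtain ⟨n, hn⟩ := hmem x y hxy
  obtain ⟨m, hm⟩ := hmem y x (hE.symm hxy)
  obtain ⟨k, hk⟩ := Function.ne_iff.1 (hψi.ne hne)
  obtain ⟨j, hj⟩ := he (n, m, k, ψ x k)
  refine ⟨j, ?_⟩
  simp only [hj]
  exact h1 _ x y ⟨⟨hn, hm⟩, rfl, Bool.eq_not.2 hk.symm⟩

end FeldmanMoore

section FreeGroupAction

variable {α Z : Type*}

theorem FreeGroup.measurable_lift_perm [MeasurableSpace Z] {g : α → Equiv.Perm Z}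
    (hg : ∀ i, Measurable (g i)) (hg' : ∀ i, Measurable ⇑(g i)⁻¹) (w : FreeGroup α) :
    Measurable (FreeGroup.lift g w) := by
  induction w with
  | C1 => simpa using measurable_id
  | of i => simpa using hg i
  | inv_of i _ => simpa using hg' i
  | mul u v hu hv => simpa using hu.comp hv

theorem FreeGroup.rel_lift_perm {E : Z → Z → Prop} (hE : Equivalence E) {g : α → Equiv.Perm Z}
    (hg : ∀ i z, E z (g i z)) (w : FreeGroup α) (z : Z) : E z (FreeGroup.lift g w z) := by
  induction w generalizing z with
  | C1 => simpa using hE.refl z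
  | of i => simpa using hg i z
  | inv_of i _ =>
    have := hE.symm (hg i ((g i)⁻¹ z))
    simpa using this
  | mul u v hu hv => simpa using hE.trans (hv z) (hu _)

end FreeGroupAction

section Universality

variable {X : Type*}

/-- The bi-infinite sequence with a first `true` at position `0`, followed by `s`. -/
def markedSeq (s : ℕ → Bool) (n : ℤ) : Bool :=
  if n < 0 then false else if n = 0 then true else s (n - 1).toNat

/-- A marked sequence is determined by any of its translates. -/
theorem markedSeq_translate_injective {s t : ℕ → Bool} {m : ℤ}
    (h : ∀ k, markedSeq s k = markedSeq t (k + m)) : m = 0 ∧ s = t := by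
  have h1 : 0 ≤ m := by
    by_contra! hm
    simpa [markedSeq, hm] using h 0
  have h2 : m ≤ 0 := by
    by_contra! hm
    simpa [markedSeq, hm] using h (-m)
  obtain rfl : m = 0 := le_antisymm h2 h1
  refine ⟨rfl, funext fun n => ?_⟩
  have h3 : ¬ ((n : ℤ) + 1 < 0) := by lia
  have h4 : ¬ ((n : ℤ) + 1 = 0) := by lia
  simpa [markedSeq, h3, h4] using h (n + 1)

/-- The generators of an action of `F₂` on `ℤ × X`: the first one translates `ℤ`, the second one
acts as `g n` on the copy of `X` indexed by `n : ℕ`. -/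
def twoGenerators (g : ℕ → Equiv.Perm X) : Bool → Equiv.Perm (ℤ × X)
  | true => (Equiv.addRight (1 : ℤ)).prodCongr (Equiv.refl X)
  | false => Equiv.prodShear (Equiv.refl ℤ) fun n => g n.toNat

theorem lift_twoGenerators_zpow (g : ℕ → Equiv.Perm X) (k m : ℤ) (x : X) :
    FreeGroup.lift (twoGenerators g) (FreeGroup.of true ^ k) (m, x) = (m + k, x) := by
  have h1 : ∀ m x, twoGenerators g true (m, x) = (m + 1, x) := fun _ _ => rfl
  have h2 : ∀ m x, (twoGenerators g true)⁻¹ (m, x) = (m - 1, x) := fun m x => by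
    rw [Equiv.Perm.inv_eq_iff_eq, h1, sub_add_cancel]
  rw [map_zpow, FreeGroup.lift_apply_of]
  induction k generalizing m with
  | zero => simp
  | succ k ih =>
    rw [zpow_add_one, Equiv.Perm.mul_apply, h1, ih]
    congr 1
    ring
  | pred k ih =>
    rw [zpow_sub_one, Equiv.Perm.mul_apply, h2, ih]
    congr 1
    ring

variable [MeasurableSpace X]

theorem measurable_twoGenerators {g : ℕ → Equiv.Perm X} (hg : ∀ n, Measurable (g n)) (b : Bool) :
    Measurable (twoGenerators g b) := by
  cases b
  · refine measurable_from_prod_countable_right fun n => ?_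
    exact measurable_const.prodMk (hg n.toNat)
  · refine measurable_from_prod_countable_right fun n => ?_
    exact measurable_const.prodMk measurable_id

theorem measurable_twoGenerators_inv {g : ℕ → Equiv.Perm X} (hg : ∀ n, Measurable ⇑(g n)⁻¹)
    (b : Bool) : Measurable ⇑(twoGenerators g b)⁻¹ := by
  cases b
  · refine measurable_from_prod_countable_right fun n => ?_
    exact measurable_const.prodMk (hg n.toNat)
  · refine measurable_from_prod_countable_right fun n => ?_
    exact measurable_const.prodMk measurable_id

theorem exists_measurable_reduction_Einf [StandardBorelSpace X] {E : X → X → Prop}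
    (hE : Equivalence E) {g : ℕ → Equiv.Perm X} (hg : ∀ n, Measurable (g n))
    (hg' : ∀ n, Measurable ⇑(g n)⁻¹) (hgE : ∀ n x, E x (g n x))
    (hEg : ∀ x y, E x y → x = y ∨ ∃ n, g n x = y) :
    ∃ θ : X → FreeGroup Bool → Bool, Measurable θ ∧ ∀ x x', E x x' ↔ Einf (θ x) (θ x') := by
  obtain ⟨ψ, hψ, hψi⟩ := MeasurableSpace.measurable_injection_nat_bool_of_countablySeparated X
  let ρ := FreeGroup.lift (twoGenerators g)
  let S : ℤ × X → Bool := fun z => markedSeq (ψ z.2) z.1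
  let Θ : ℤ × X → FreeGroup Bool → Bool := fun z u => S (ρ u⁻¹ z)
  have hΘ : ∀ w z u, Θ (ρ w z) u = Θ z (w⁻¹ * u) := fun w z u => by
    simp only [Θ, mul_inv_rev, inv_inv, map_mul, Equiv.Perm.mul_apply]
  have hS : Measurable S := by
    refine measurable_from_prod_countable_right fun n => ?_
    simp only [S, markedSeq]
    split_ifs
    · exact measurable_const
    · exact measurable_const
    · exact (measurable_pi_apply _).comp hψ
  have hρE : ∀ w z, E z.2 (ρ w z).2 := by
    refine FreeGroup.rel_lift_perm (E := fun z z' : ℤ × X => E z.2 z'.2) (hE.comap _) ?_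
    rintro (_ | _) ⟨n, x⟩
    · exact hgE _ x
    · exact hE.refl x
  refine ⟨fun x => Θ (0, x), measurable_pi_lambda _ fun u => ?_, fun x x' => ⟨fun h => ?_, ?_⟩⟩
  · exact hS.comp ((FreeGroup.measurable_lift_perm (measurable_twoGenerators hg)
      (measurable_twoGenerators_inv hg') u⁻¹).comp (measurable_const.prodMk measurable_id))
  · obtain ⟨w, hw⟩ : ∃ w, ρ w (0, x) = (0, x') := by
      rcases hEg x x' h with rfl | ⟨n, rfl⟩
      · exact ⟨1, by simp⟩
      · refine ⟨FreeGroup.of true ^ (-n : ℤ) * FreeGroup.of false * FreeGroup.of true ^ (n : ℤ), ?_⟩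
        have hb : ∀ x, ρ (FreeGroup.of false) ((n : ℤ), x) = ((n : ℤ), g n x) := fun x => by
          simp only [ρ, FreeGroup.lift_apply_of]
          rfl
        simp only [map_mul, Equiv.Perm.mul_apply]
        rw [lift_twoGenerators_zpow g n 0 x, zero_add, hb, lift_twoGenerators_zpow g (-n) n,
          add_neg_cancel]
    exact ⟨w, fun u => by simp only [← hΘ, hw]⟩
  · rintro ⟨w, hw⟩
    rcases hz : ρ w (0, x) with ⟨m, y⟩
    have hxy : E x y := by simpa [hz] using hρE w (0, x)
    have key : ∀ k, markedSeq (ψ x') k = markedSeq (ψ y) (k + m) := by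
      intro k
      have h := hw (FreeGroup.of true ^ k)⁻¹
      simp only [← hΘ, hz] at h
      simp only [Θ, S, inv_inv, ρ, lift_twoGenerators_zpow, zero_add] at h
      rw [h, add_comm]
    rwa [hψi (markedSeq_translate_injective key).2]

end Universality

/-- Feldman–Moore and reducibility to `E∞`: every countable Borel
equivalence relation `E` on a Polish space `X` (i) is the orbit equivalence relation
of a Borel action of a countable group on `X`, and (ii) is Borel reducible to
`E∞ = E(F₂,2)`. -/
theorem feldman_moore_and_Einf_universality
    {X : Type*} [TopologicalSpace X] [PolishSpace X]
    (E : X → X → Prop) (hE : Equivalence E)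
    (hBorel : MeasurableSet[borel (X × X)] {p : X × X | E p.1 p.2})
    (hctble : ∀ x : X, {y : X | E x y}.Countable) :
    (∃ (G : Type) (_ : Group G), Countable G ∧
      ∃ a : G → X → X,
        (∀ g : G, @Measurable X X (borel X) (borel X) (a g)) ∧
        (∀ x : X, a 1 x = x) ∧
        (∀ (g h : G) (x : X), a g (a h x) = a (g * h) x) ∧
        (∀ x y : X, E x y ↔ ∃ g : G, a g x = y)) ∧
    BorelReducible E Einf := by
  let _ : MeasurableSpace X := borel X
  have _ : BorelSpace X := ⟨rfl⟩
  rw [← BorelSpace.measurable_eq] at hBorel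
  obtain ⟨h, hm, hi, hhE, hEh⟩ := exists_involutions_of_countable_equivalence hE hBorel hctble
  let g : ℕ → Equiv.Perm X := fun n => (hi n).toPerm
  refine ⟨⟨FreeGroup ℕ, inferInstance, inferInstance, fun w => FreeGroup.lift g w,
    FreeGroup.measurable_lift_perm hm hm, fun x => by simp, fun u v x => by simp,
    fun x y => ?_⟩, ?_⟩
  · constructor
    · intro hxy
      rcases hEh x y hxy with rfl | ⟨n, rfl⟩
      · exact ⟨1, by simp⟩
      · exact ⟨FreeGroup.of n, by simp [g]⟩
    · rintro ⟨w, rfl⟩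
      exact FreeGroup.rel_lift_perm hE hhE w x
  · obtain ⟨θ, hθ, h⟩ := exists_measurable_reduction_Einf hE (g := g) hm hm hhE hEh
    refine ⟨θ, ?_, h⟩
    rwa [← BorelSpace.measurable_eq (α := FreeGroup Bool → Bool)]
end

section
/- The equivalence relation E∞ = E(F₂,2) is not hyperfinite: there is no increasing sequence (F_n) of Borel equivalence relations on 2^{F₂}, each with all classes finite, whose union is E∞. Consequently E₀ <B E∞ strictly: E₀ is Borel reducible to E∞, but E∞ is not Borel reducible to E₀. -/
open MeasureTheory

/-- `E₀`: eventual equality on Cantor space `2^ℕ`. -/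
def E0 (x y : ℕ → Bool) : Prop := {n : ℕ | x n ≠ y n}.Finite

open scoped ENNReal

namespace FreeShift

/-- The free group on two generators. -/
abbrev F2 : Type := FreeGroup Bool

/-- The shift action of the free group on `2^{F₂}`. -/
def shift (w : F2) (x : F2 → Bool) : F2 → Bool := fun u => x (w⁻¹ * u)

@[simp] lemma shift_one (x : F2 → Bool) : shift 1 x = x := by
  ext u; simp [shift]

lemma shift_shift (v w : F2) (x : F2 → Bool) : shift v (shift w x) = shift (v * w) x := by
  ext u; simp [shift, mul_assoc]

lemma Einf_iff (x y : F2 → Bool) : Einf x y ↔ ∃ w, y = shift w x := by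
  simp only [Einf, funext_iff, shift]

lemma measurable_shift (w : F2) : Measurable (shift w) :=
  measurable_pi_lambda _ fun u => measurable_pi_apply (w⁻¹ * u)

/-- The fair coin. -/
noncomputable def coin : Measure Bool := (PMF.uniformOfFintype Bool).toMeasure

instance : IsProbabilityMeasure coin := by unfold coin; infer_instance

lemma coin_singleton (b : Bool) : coin {b} = 2⁻¹ := by
  simp [coin]

/-- The Bernoulli measure on `2^{F₂}`. -/
noncomputable def bernoulli : Measure (F2 → Bool) := Measure.infinitePi fun _ => coin

instance : IsProbabilityMeasure bernoulli := by unfold bernoulli; infer_instance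

lemma measurePreserving_shift (w : F2) : MeasurePreserving (shift w) bernoulli bernoulli := by
  refine ⟨measurable_shift w, ?_⟩
  have h := Measure.infinitePi_map_piCongrLeft (X := fun _ : F2 => Bool) (fun _ => coin)
    (Equiv.mulLeft w)
  have e : ⇑(MeasurableEquiv.piCongrLeft (fun _ : F2 => Bool) (Equiv.mulLeft w)) = shift w := by
    ext x u
    rw [← (Equiv.mulLeft w).apply_symm_apply u]
    simp only [MeasurableEquiv.coe_piCongrLeft, Equiv.piCongrLeft_apply_apply]
    simp [shift]
  rw [e] at h
  exact h

lemma shift_pow_one {g : F2} {x : F2 → Bool} (h : shift g x = x) (n : ℕ) : x (g ^ n) = x 1 := by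
  induction n with
  | zero => simp
  | succ n ih =>
    rw [← ih, ← congrFun h (g ^ (n + 1))]
    simp [shift, pow_succ']

lemma bernoulli_pi_singleton (s : Finset F2) (b : Bool) :
    bernoulli (Set.pi s fun _ => {b}) = 2⁻¹ ^ s.card := by
  rw [bernoulli, Measure.infinitePi_pi _ (fun _ _ => MeasurableSet.singleton b)]
  simp [coin_singleton]

lemma bernoulli_fixed {g : F2} (hg : g ≠ 1) : bernoulli {x | shift g x = x} = 0 := by
  have hinj : Function.Injective fun n : ℕ => g ^ n :=
    injective_pow_iff_not_isOfFinOrder.2 (not_isOfFinOrder_of_isMulTorsionFree hg)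
  have hb (b : Bool) : bernoulli {x | shift g x = x ∧ x 1 = b} = 0 := by
    refine le_antisymm (ge_of_tendsto'
      (ENNReal.tendsto_pow_atTop_nhds_zero_of_lt_one (r := 2⁻¹) (by simp)) fun n => ?_) zero_le
    rw [← Finset.card_range n, ← Finset.card_image_of_injective _ hinj,
      ← bernoulli_pi_singleton _ b]
    refine measure_mono fun x hx => ?_
    simp only [Set.mem_pi, Finset.coe_image, Set.mem_image, Set.mem_singleton_iff]
    rintro _ ⟨k, -, rfl⟩
    rw [shift_pow_one hx.1, hx.2]
  refine measure_mono_null (t := ⋃ b, {x | shift g x = x ∧ x 1 = b}) ?_ (measure_iUnion_null hb)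
  intro x hx
  simpa using hx

/-- Almost every point has trivial stabilizer. -/
lemma ae_injective_shift : ∀ᵐ x ∂bernoulli, Function.Injective fun w => shift w x := by
  have h : ∀ᵐ x ∂bernoulli, ∀ g : F2, g ≠ 1 → shift g x ≠ x := by
    refine ae_all_iff.2 fun g => ?_
    by_cases hg : g = 1
    · simp [hg]
    · simpa [hg, ae_iff] using bernoulli_fixed hg
  filter_upwards [h] with x hx v w hvw
  by_contra hne
  refine hx (w⁻¹ * v) (fun h1 => hne (inv_mul_eq_one.1 h1).symm) ?_
  have := congrArg (shift w⁻¹) hvw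
  simpa [shift_shift] using this

/-- The mass that the weights `p` on `F₂` give to the set `V`. -/
noncomputable def mass (p : F2 → (F2 → Bool) → ℝ≥0∞) (V : Set F2) (x : F2 → Bool) : ℝ≥0∞ :=
  ∑' γ, V.indicator (fun γ => p γ x) γ

variable {p : F2 → (F2 → Bool) → ℝ≥0∞}

lemma measurable_mass (hp : ∀ γ, Measurable (p γ)) (V : Set F2) : Measurable (mass p V) := by
  refine Measurable.tsum fun γ => ?_
  by_cases h : γ ∈ V <;> simp [h, hp γ]

lemma mass_mono {V W : Set F2} (h : V ⊆ W) (x : F2 → Bool) : mass p V x ≤ mass p W x :=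
  ENNReal.tsum_le_tsum fun γ => Set.indicator_le_indicator_of_subset h (fun _ => zero_le) γ

lemma mass_union {V W : Set F2} (h : Disjoint V W) (x : F2 → Bool) :
    mass p (V ∪ W) x = mass p V x + mass p W x := by
  simp only [mass, ← ENNReal.tsum_add]
  refine tsum_congr fun γ => ?_
  rw [Set.indicator_union_of_disjoint h]

lemma mass_univ (x : F2 → Bool) : mass p Set.univ x = ∑' γ, p γ x := by
  simp [mass]

open FreeGroup in
lemma one_le_lintegral_mass (hp : ∀ γ, Measurable (p γ))
    (hsum : ∀ᵐ x ∂bernoulli, ∑' γ, p γ x = 1) {B : Set (F2 → Bool)} (hB : MeasurableSet B) (i : Bool)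
    (h : ∀ x ∉ B, ∀ γ, p γ (shift (of i) x) = p ((of i)⁻¹ * γ) x) :
    1 ≤ ∫⁻ x, mass p (startsWith (i, true) ∪ startsWith (i, false)) x ∂bernoulli + bernoulli B := by
  set S : Set F2 := startsWith (i, true)
  set S' : Set F2 := startsWith (i, false)
  have hdisj : Disjoint S S' := by simp [S, S']
  have hsum' := (measurePreserving_shift (of i)).quasiMeasurePreserving.ae hsum
  have hle : ∀ᵐ x ∂bernoulli, mass p Sᶜ (shift (of i) x) ≤ mass p S' x + B.indicator 1 x := by
    filter_upwards [hsum'] with x hx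
    by_cases hxB : x ∈ B
    · refine le_trans (mass_mono (Set.subset_univ _) _) ?_
      rw [mass_univ, hx]
      simp [hxB]
    · simp only [hxB, not_false_eq_true, Set.indicator_of_notMem, add_zero]
      unfold mass
      rw [← (Equiv.mulLeft (of i)).tsum_eq]
      refine ENNReal.tsum_le_tsum fun γ => ?_
      by_cases hγ : of i * γ ∈ S
      · simp [hγ]
      · have h1 : γ ∈ S' := by
          have := startsWith_mk_mul (w := (i, false)) (of i * γ) (by simpa using hγ)
          have e : (mk [(i, false)] : F2) = (of i)⁻¹ := rfl
          rwa [e, inv_mul_cancel_left] at this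
        simp [hγ, h1, h x hxB]
  calc (1 : ℝ≥0∞) = ∫⁻ x, mass p (S ∪ Sᶜ) x ∂bernoulli := by
        rw [Set.union_compl_self, lintegral_congr_ae (g := fun _ => 1)]
        · simp
        · filter_upwards [hsum] with x hx
          rw [mass_univ, hx]
    _ = ∫⁻ x, mass p S x ∂bernoulli + ∫⁻ x, mass p Sᶜ (shift (of i) x) ∂bernoulli := by
        simp_rw [mass_union (disjoint_compl_right : Disjoint S Sᶜ)]
        rw [lintegral_add_left (measurable_mass hp S),
          (measurePreserving_shift (of i)).lintegral_comp (measurable_mass hp Sᶜ)]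
    _ ≤ ∫⁻ x, mass p S x ∂bernoulli + ∫⁻ x, mass p S' x + B.indicator 1 x ∂bernoulli := by
        gcongr 1
        exact lintegral_mono_ae hle
    _ = _ := by
        simp_rw [mass_union hdisj]
        rw [lintegral_add_left (measurable_mass hp S), lintegral_add_left (measurable_mass hp S'),
          lintegral_indicator_one hB, add_assoc]

open FreeGroup in
/-- Quantitative nonamenability of `F₂`: almost everywhere normalized weights are not almost
invariant under both generators. -/
lemma one_le_bernoulli_add (hp : ∀ γ, Measurable (p γ))
    (hsum : ∀ᵐ x ∂bernoulli, ∑' γ, p γ x = 1) {B : Bool → Set (F2 → Bool)}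
    (hB : ∀ i, MeasurableSet (B i))
    (h : ∀ i, ∀ x ∉ B i, ∀ γ, p γ (shift (of i) x) = p ((of i)⁻¹ * γ) x) :
    1 ≤ bernoulli (B true) + bernoulli (B false) := by
  have h1 := one_le_lintegral_mass hp hsum (hB true) true (h true)
  have h2 := one_le_lintegral_mass hp hsum (hB false) false (h false)
  have hdisj : Disjoint (startsWith (true, true) ∪ startsWith (true, false) : Set F2)
      (startsWith (false, true) ∪ startsWith (false, false)) := by
    simp [Set.disjoint_union_left, Set.disjoint_union_right]
  have h3 : ∫⁻ x, mass p (startsWith (true, true) ∪ startsWith (true, false)) x ∂bernoulli +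
      ∫⁻ x, mass p (startsWith (false, true) ∪ startsWith (false, false)) x ∂bernoulli ≤ 1 := by
    rw [← lintegral_add_left (measurable_mass hp _)]
    refine (lintegral_mono_ae (g := fun _ => 1) ?_).trans (by simp)
    filter_upwards [hsum] with x hx
    rw [← mass_union hdisj, ← hx, ← mass_univ]
    exact mass_mono (Set.subset_univ _) x
  have h4 : (1 : ℝ≥0∞) + 1 ≤ 1 + (bernoulli (B true) + bernoulli (B false)) := by
    refine (add_le_add h1 h2).trans ?_
    rw [add_add_add_comm]
    gcongr
  exact (ENNReal.add_le_add_iff_left ENNReal.one_ne_top).1 h4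

open FreeGroup in
/-- The orbit equivalence relation of the shift is not an increasing union of Borel relations
whose classes carry Borel families of probability weights. -/
lemma false_of_weights {R : ℕ → (F2 → Bool) → (F2 → Bool) → Prop}
    (hR : ∀ n g, MeasurableSet {x | R n x (shift g x)})
    (hmono : ∀ n x y, R n x y → R (n + 1) x y)
    (hunion : ∀ x g, ∃ n, R n x (shift g x))
    (p : ℕ → F2 → (F2 → Bool) → ℝ≥0∞) (hp : ∀ n γ, Measurable (p n γ))
    (hsum : ∀ n, ∀ᵐ x ∂bernoulli, ∑' γ, p n γ x = 1)
    (hinv : ∀ n x g, R n x (shift g x) → ∀ γ, p n γ (shift g x) = p n (g⁻¹ * γ) x) : False := by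
  have hlim (i : Bool) : Filter.Tendsto (fun n => bernoulli {x | R n x (shift (of i) x)}ᶜ)
      Filter.atTop (nhds 0) := by
    have hanti : Antitone fun n => {x | R n x (shift (of i) x)}ᶜ :=
      antitone_nat_of_succ_le fun n => Set.compl_subset_compl.2 fun x => hmono n x _
    have hempty : ⋂ n, {x | R n x (shift (of i) x)}ᶜ = ∅ := by
      ext x
      simpa using hunion x (of i)
    have := tendsto_measure_iInter_atTop (μ := bernoulli)
      (fun n => (hR n (of i)).compl.nullMeasurableSet) hanti ⟨0, measure_ne_top _ _⟩
    rwa [hempty, measure_empty] at this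
  have hadd := (hlim true).add (hlim false)
  rw [add_zero] at hadd
  obtain ⟨n, hn⟩ := (hadd.eventually_lt_const zero_lt_one).exists
  refine hn.not_ge (one_le_bernoulli_add (hp n) (hsum n)
    (B := fun i => {x | R n x (shift (of i) x)}ᶜ) (fun i => (hR n _).compl) ?_)
  intro i x hx γ
  exact hinv n x _ (by simpa using hx) γ

/-- The uniform weights on the class of `x` under a relation with finite classes. -/
noncomputable def uniformWeight (R : (F2 → Bool) → (F2 → Bool) → Prop) (γ : F2)
    (x : F2 → Bool) : ℝ≥0∞ :=
  {x | R x (shift γ⁻¹ x)}.indicator 1 x / ∑' δ : F2, {x | R x (shift δ⁻¹ x)}.indicator 1 x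

lemma measurable_uniformWeight {R : (F2 → Bool) → (F2 → Bool) → Prop}
    (hR : ∀ g, MeasurableSet {x | R x (shift g x)}) (γ : F2) : Measurable (uniformWeight R γ) :=
  (measurable_one.indicator (hR _)).div
    (Measurable.tsum fun _ => measurable_one.indicator (hR _))

lemma uniformWeight_shift {R : (F2 → Bool) → (F2 → Bool) → Prop} (hR : Equivalence R)
    {x : F2 → Bool} {g : F2} (hx : R x (shift g x)) (γ : F2) :
    uniformWeight R γ (shift g x) = uniformWeight R (g⁻¹ * γ) x := by
  have key (δ : F2) : {x | R x (shift δ⁻¹ x)}.indicator (1 : (F2 → Bool) → ℝ≥0∞) (shift g x) =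
      {x | R x (shift (g⁻¹ * δ)⁻¹ x)}.indicator 1 x := by
    have : shift g x ∈ {x | R x (shift δ⁻¹ x)} ↔ x ∈ {x | R x (shift (g⁻¹ * δ)⁻¹ x)} := by
      rw [Set.mem_ofPred_eq, Set.mem_ofPred_eq, shift_shift, mul_inv_rev, inv_inv]
      exact ⟨hR.trans hx, hR.trans (hR.symm hx)⟩
    by_cases h : x ∈ {x | R x (shift (g⁻¹ * δ)⁻¹ x)}
    · rw [Set.indicator_of_mem (this.2 h), Set.indicator_of_mem h]; rfl
    · rw [Set.indicator_of_notMem (mt this.1 h), Set.indicator_of_notMem h]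
  unfold uniformWeight
  simp_rw [key]
  congr 1
  exact (Equiv.mulLeft g⁻¹).tsum_eq
    fun δ => {x | R x (shift δ⁻¹ x)}.indicator (1 : (F2 → Bool) → ℝ≥0∞) x

lemma tsum_uniformWeight {R : (F2 → Bool) → (F2 → Bool) → Prop} (hR : Equivalence R)
    {x : F2 → Bool} (hfin : {y | R x y}.Finite) (hx : Function.Injective fun w => shift w x) :
    ∑' γ, uniformWeight R γ x = 1 := by
  simp only [uniformWeight, div_eq_mul_inv, ENNReal.tsum_mul_right]
  have hfin' : {δ : F2 | R x (shift δ⁻¹ x)}.Finite :=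
    hfin.preimage (hx.comp inv_injective).injOn
  refine ENNReal.mul_inv_cancel (fun h => ?_) ?_
  · have := ENNReal.tsum_eq_zero.1 h 1
    simp [hR.refl x] at this
  · have h1 (δ : F2) (hδ : δ ∉ hfin'.toFinset) :
        {x | R x (shift δ⁻¹ x)}.indicator (1 : (F2 → Bool) → ℝ≥0∞) x = 0 := by
      simpa using hδ
    rw [tsum_eq_sum h1]
    refine (ENNReal.sum_lt_top.2 fun δ _ => ?_).ne
    exact (Set.indicator_le_self' (fun _ _ => zero_le) x).trans_lt (by simp)

theorem not_hyperfinite : ¬ ∃ F : ℕ → (F2 → Bool) → (F2 → Bool) → Prop,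
    (∀ n, Equivalence (F n)) ∧
    (∀ n, MeasurableSet {p : (F2 → Bool) × (F2 → Bool) | F n p.1 p.2}) ∧
    (∀ n x, {y | F n x y}.Finite) ∧
    (∀ n x y, F n x y → F (n + 1) x y) ∧
    (∀ x y, Einf x y ↔ ∃ n, F n x y) := by
  rintro ⟨F, heq, hmeas, hfin, hmono, hunion⟩
  have hF (n : ℕ) (g : F2) : MeasurableSet {x | F n x (shift g x)} :=
    (measurable_id.prodMk (measurable_shift g)) (hmeas n)
  refine false_of_weights hF hmono (fun x g => (hunion _ _).1 ((Einf_iff _ _).2 ⟨g, rfl⟩))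
    (fun n => uniformWeight (F n)) (fun n => measurable_uniformWeight (hF n)) (fun n => ?_)
    (fun n x g hx => uniformWeight_shift (heq n) hx)
  filter_upwards [ae_injective_shift] with x hx
  exact tsum_uniformWeight (heq n) (hfin n x) hx

open ProbabilityTheory in
/-- Weights on the fibres of `φ`, obtained by disintegrating the Bernoulli measure over `φ`. -/
noncomputable def fiberWeight (φ : (F2 → Bool) → ℕ → Bool) (γ : F2) (x : F2 → Bool) : ℝ≥0∞ :=
  condDistrib id φ bernoulli (φ x) {shift γ⁻¹ x}

lemma measurable_fiberWeight {φ : (F2 → Bool) → ℕ → Bool} (hφ : Measurable φ) (γ : F2) :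
    Measurable (fiberWeight φ γ) := by
  have ht : MeasurableSet {q : (F2 → Bool) × (F2 → Bool) | q.2 = shift γ⁻¹ q.1} :=
    measurableSet_eq_fun measurable_snd ((measurable_shift _).comp measurable_fst)
  exact ProbabilityTheory.Kernel.measurable_kernel_prodMk_left
    (κ := (ProbabilityTheory.condDistrib id φ bernoulli).comap φ hφ) ht

lemma tsum_fiberWeight {φ : (F2 → Bool) → ℕ → Bool} (hφ : Measurable φ)
    (hfib : ∀ x y, φ y = φ x → Einf x y) :
    ∀ᵐ x ∂bernoulli, ∑' γ, fiberWeight φ γ x = 1 := by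
  have ht : MeasurableSet {q : (ℕ → Bool) × (F2 → Bool) | φ q.2 = q.1} :=
    measurableSet_eq_fun (hφ.comp measurable_snd) measurable_fst
  have h1 : ∀ᵐ q ∂(bernoulli.map φ).compProd (ProbabilityTheory.condDistrib id φ bernoulli),
      φ q.2 = q.1 := by
    rw [ProbabilityTheory.compProd_map_condDistrib aemeasurable_id,
      ae_map_iff (by fun_prop) ht]
    simp
  have h2 := ae_of_ae_map hφ.aemeasurable (Measure.ae_ae_of_ae_compProd h1)
  filter_upwards [h2, ae_injective_shift] with x hx hinj
  have hinj' : Function.Injective fun γ : F2 => shift γ⁻¹ x := hinj.comp inv_injective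
  simp only [fiberWeight]
  rw [← measure_iUnion (fun γ δ h => by simpa using hinj'.ne h)
    (fun γ => MeasurableSet.singleton _)]
  refine le_antisymm prob_le_one ?_
  refine (prob_compl_eq_zero_iff (ht.preimage measurable_prodMk_left)).1 hx |>.symm.le.trans
    (measure_mono fun y hy => ?_)
  obtain ⟨w, rfl⟩ := (Einf_iff x y).1 (hfib x y hy)
  exact Set.mem_iUnion.2 ⟨w⁻¹, by simp⟩

theorem not_borelReducible_E0 : ¬ BorelReducible Einf E0 := by
  rintro ⟨θ, hθ, hred⟩
  have hθ' : Measurable θ := by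
    rwa [← BorelSpace.measurable_eq (α := F2 → Bool), ← BorelSpace.measurable_eq (α := ℕ → Bool)]
      at hθ
  let φ (n : ℕ) (x : F2 → Bool) : ℕ → Bool := fun k => θ x (n + k)
  have hφ (n : ℕ) : Measurable (φ n) :=
    measurable_pi_lambda _ fun k => (measurable_pi_apply _).comp hθ'
  have hE0 (u v : ℕ → Bool) : E0 u v ↔ ∃ n, ∀ k, u (n + k) = v (n + k) := by
    constructor
    · intro h
      obtain ⟨n, hn⟩ := h.bddAbove
      refine ⟨n + 1, fun k => ?_⟩
      by_contra hk
      have : n + 1 + k ≤ n := hn hk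
      omega
    · rintro ⟨n, hn⟩
      refine (Set.finite_lt_nat n).subset fun m hm => ?_
      by_contra hlt
      obtain ⟨k, rfl⟩ := Nat.exists_eq_add_of_le (not_lt.1 hlt)
      exact hm (hn k)
  have hfib (n : ℕ) (x y : F2 → Bool) (h : φ n y = φ n x) : Einf x y :=
    (hred x y).2 ((hE0 _ _).2 ⟨n, fun k => (congrFun h k).symm⟩)
  refine false_of_weights (R := fun n x y => φ n x = φ n y)
    (fun n g => measurableSet_eq_fun (hφ n) ((hφ n).comp (measurable_shift g)))
    (fun n x y h => ?_) (fun x g => ?_)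
    (fun n => fiberWeight (φ n)) (fun n => measurable_fiberWeight (hφ n))
    (fun n => tsum_fiberWeight (hφ n) (hfib n)) (fun n x g hx γ => ?_)
  · funext k
    simpa [φ, add_assoc, add_comm, add_left_comm] using congrFun h (k + 1)
  · obtain ⟨n, hn⟩ := (hE0 _ _).1 ((hred _ _).1 ((Einf_iff _ (shift g x)).2 ⟨g, rfl⟩))
    exact ⟨n, funext hn⟩
  · simp only [fiberWeight, ← hx, shift_shift, mul_inv_rev, inv_inv]

/-- Flip the bit at position `k`; nothing happens when `k` is negative. -/
def flip (v : (ℕ → Bool) × ℤ) : (ℕ → Bool) × ℤ :=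
  (fun n => if (n : ℤ) = v.2 then !(v.1 n) else v.1 n, v.2)

lemma flip_flip (v : (ℕ → Bool) × ℤ) : flip (flip v) = v := by
  ext n
  · simp only [flip]; split_ifs <;> simp
  · rfl

lemma continuous_flip : Continuous flip := by
  refine continuous_prod_of_discrete_right.2 fun k => ?_
  refine Continuous.prodMk (continuous_pi fun n => ?_) continuous_const
  simp only
  split_ifs
  · exact (continuous_of_discreteTopology (f := not)).comp (continuous_apply n)
  · exact continuous_apply n

/-- `flip` as a homeomorphism. -/
def flipHomeo : ((ℕ → Bool) × ℤ) ≃ₜ ((ℕ → Bool) × ℤ) where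
  toFun := flip
  invFun := flip
  left_inv := flip_flip
  right_inv := flip_flip
  continuous_toFun := continuous_flip
  continuous_invFun := continuous_flip

/-- Move the pointer one step to the right. -/
def stepHomeo : ((ℕ → Bool) × ℤ) ≃ₜ ((ℕ → Bool) × ℤ) :=
  (Homeomorph.refl _).prodCongr (Homeomorph.addRight 1)

/-- The action of `F₂` on pointed sequences: one generator moves the pointer, the other flips the
bit under the pointer. -/
def pointerAction : F2 →* (((ℕ → Bool) × ℤ) ≃ₜ ((ℕ → Bool) × ℤ)) :=
  FreeGroup.lift fun i => if i then flipHomeo else stepHomeo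

lemma pointerAction_flip (v : (ℕ → Bool) × ℤ) :
    pointerAction (FreeGroup.of true) v = flip v := by
  simp [pointerAction, flipHomeo]

lemma pointerAction_step (v : (ℕ → Bool) × ℤ) :
    pointerAction (FreeGroup.of false) v = (v.1, v.2 + 1) := by
  simp [pointerAction, stepHomeo]; rfl

lemma pointerAction_step_zpow (j : ℤ) (v : (ℕ → Bool) × ℤ) :
    pointerAction (FreeGroup.of false ^ j) v = (v.1, v.2 + j) := by
  induction j generalizing v with
  | zero => simp
  | succ j ih =>
    rw [zpow_add_one, map_mul, Homeomorph.mul_apply, pointerAction_step, ih]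
    ext <;> simp; ring
  | pred j ih =>
    have h : pointerAction (FreeGroup.of false)⁻¹ v = (v.1, v.2 - 1) := by
      rw [map_inv, Homeomorph.inv_apply, Homeomorph.symm_apply_eq, pointerAction_step]
      simp
    rw [zpow_sub_one, map_mul, Homeomorph.mul_apply, h, ih]
    ext <;> simp; ring

lemma E0_equivalence : Equivalence E0 where
  refl x := by simp [E0]
  symm h := by simpa only [E0, ne_comm] using h
  trans {x y z} h h' := (h.union h').subset fun n hn => by
    by_contra hc
    simp only [Set.mem_union, Set.mem_ofPred_eq, not_or, not_not] at hc
    exact hn (hc.1.trans hc.2)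

lemma E0_flip (v : (ℕ → Bool) × ℤ) : E0 v.1 (flip v).1 := by
  refine (Set.finite_singleton v.2.toNat).subset fun n hn => ?_
  by_contra hc
  refine hn ?_
  have : (n : ℤ) ≠ v.2 := fun h => hc (by simp [← h])
  simp [flip, this]

lemma E0_pointerAction (w : F2) (v : (ℕ → Bool) × ℤ) : E0 v.1 (pointerAction w v).1 := by
  induction w using FreeGroup.induction_on generalizing v with
  | C1 => simpa using E0_equivalence.refl v.1
  | of i =>
    cases i
    · rw [pointerAction_step]; exact E0_equivalence.refl _
    · rw [pointerAction_flip]; exact E0_flip v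
  | inv_of i ih =>
    have := ih (pointerAction (FreeGroup.of i)⁻¹ v)
    rw [← Homeomorph.mul_apply, ← map_mul, mul_inv_cancel, map_one] at this
    exact E0_equivalence.symm this
  | mul v w hv hw =>
    rw [map_mul, Homeomorph.mul_apply]
    exact E0_equivalence.trans (hw _) (hv _)

lemma exists_pointerAction {x y : ℕ → Bool} (h : E0 x y) :
    ∃ w, pointerAction w (x, 0) = (y, 0) := by
  have key (s : Finset ℕ) : ∀ x, {n | x n ≠ y n} ⊆ (s : Set ℕ) →
      ∃ w, pointerAction w (x, 0) = (y, 0) := by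
    induction s using Finset.induction_on with
    | empty =>
      intro x hx
      refine ⟨1, ?_⟩
      have : x = y := funext fun n => by
        by_contra hn
        simpa using hx hn
      simp [this]
    | insert k s hk ih =>
      intro x hx
      by_cases hxy : x k = y k
      · refine ih x fun n hn => ?_
        rcases Finset.mem_insert.1 (hx hn) with rfl | h
        · exact absurd hxy hn
        · exact h
      · obtain ⟨w, hw⟩ := ih (flip (x, k)).1 fun n hn => by
          by_cases hnk : n = k
          · subst hnk
            simp only [flip, Set.mem_ofPred_eq] at hn
            cases hx : x n <;> cases hy : y n <;> simp_all
          · simp only [flip, Set.mem_ofPred_eq, Nat.cast_inj, hnk, if_false] at hn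
            exact (Finset.mem_insert.1 (hx hn)).resolve_left hnk
        refine ⟨w * (FreeGroup.of false ^ (-(k : ℤ)) * FreeGroup.of true *
          FreeGroup.of false ^ (k : ℤ)), ?_⟩
        simp only [map_mul, Homeomorph.mul_apply, pointerAction_step_zpow, pointerAction_flip]
        rw [← hw]
        simp [flip]
  exact key h.toFinset x h.coe_toFinset.superset

/-- The bit under the pointer, `false` when the pointer is negative. -/
def readBit (v : (ℕ → Bool) × ℤ) : Bool := if 0 ≤ v.2 then v.1 v.2.toNat else false

lemma continuous_readBit : Continuous readBit := by
  refine continuous_prod_of_discrete_right.2 fun k => ?_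
  simp only [readBit]
  split_ifs
  · exact continuous_apply _
  · exact continuous_const

lemma readBit_flip (v : (ℕ → Bool) × ℤ) : readBit (flip v) = readBit v ↔ v.2 < 0 := by
  by_cases h : 0 ≤ v.2
  · simp [readBit, flip, h]
  · simp [readBit, flip, h, not_le.1 h]

/-- The name of a pointed sequence under the pointer action. -/
def name (v : (ℕ → Bool) × ℤ) : F2 → Bool := fun u => readBit (pointerAction u⁻¹ v)

lemma shift_name (w : F2) (v : (ℕ → Bool) × ℤ) : shift w (name v) = name (pointerAction w v) := by
  ext u
  simp only [shift, name, ← Homeomorph.mul_apply, ← map_mul, mul_inv_rev, inv_inv]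

lemma continuous_name : Continuous name :=
  continuous_pi fun u => continuous_readBit.comp (pointerAction u⁻¹).continuous

lemma name_injective : Function.Injective name := by
  intro v v' h
  have hread (w : F2) : readBit (pointerAction w v) = readBit (pointerAction w v') := by
    simpa [name] using congrFun h w⁻¹
  have hneg (j : ℤ) : v.2 + j < 0 ↔ v'.2 + j < 0 := by
    have h1 := hread (FreeGroup.of false ^ j)
    have h2 := hread (FreeGroup.of true * FreeGroup.of false ^ j)
    simp only [map_mul, Homeomorph.mul_apply, pointerAction_step_zpow, pointerAction_flip] at h1 h2
    have h3 := readBit_flip (v.1, v.2 + j)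
    have h4 := readBit_flip (v'.1, v'.2 + j)
    rw [h1, h2] at h3
    exact h3.symm.trans h4
  have hpos : v.2 = v'.2 := by
    have h1 := hneg (-v.2)
    have h2 := hneg (-v'.2)
    omega
  refine Prod.ext (funext fun n => ?_) hpos
  have h1 := hread (FreeGroup.of false ^ ((n : ℤ) - v.2))
  simp only [pointerAction_step_zpow] at h1
  simpa [readBit, hpos] using h1

theorem borelReducible_E0_Einf : BorelReducible E0 Einf := by
  refine ⟨fun x => name (x, 0), ?_, fun x y => ?_⟩
  · exact (continuous_name.comp (Continuous.prodMk_left 0)).borel_measurable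
  · rw [Einf_iff]
    constructor
    · intro h
      obtain ⟨w, hw⟩ := exists_pointerAction h
      exact ⟨w, by rw [shift_name, hw]⟩
    · rintro ⟨w, hw⟩
      rw [shift_name] at hw
      have := E0_pointerAction w (x, 0)
      rwa [← name_injective hw] at this

end FreeShift

/-- `E∞` is not hyperfinite (it is not the union of an increasing
sequence of finite Borel equivalence relations); consequently `E₀ <B E∞` strictly. -/
theorem Einf_not_hyperfinite :
    (¬ ∃ F : ℕ → (FreeGroup Bool → Bool) → (FreeGroup Bool → Bool) → Prop,
        (∀ n, Equivalence (F n)) ∧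
        (∀ n, MeasurableSet[borel ((FreeGroup Bool → Bool) × (FreeGroup Bool → Bool))]
          {p : (FreeGroup Bool → Bool) × (FreeGroup Bool → Bool) | F n p.1 p.2}) ∧
        (∀ n x, {y : FreeGroup Bool → Bool | F n x y}.Finite) ∧
        (∀ n x y, F n x y → F (n + 1) x y) ∧
        (∀ x y, Einf x y ↔ ∃ n, F n x y)) ∧
    BorelReducible E0 Einf ∧ ¬ BorelReducible Einf E0 := by
  refine ⟨?_, FreeShift.borelReducible_E0_Einf, FreeShift.not_borelReducible_E0⟩
  rw [← BorelSpace.measurable_eq (α := (FreeGroup Bool → Bool) × (FreeGroup Bool → Bool))]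
  exact FreeShift.not_hyperfinite
end

section
/- Let r : ℕ → ℝ satisfy r(n) ≥ 0 for all n, r(n) → 0 as n → ∞, and ∑_n r(n) = ∞. Then the summable equivalence relation E_{S_r} is not Borel reducible to the density-zero equivalence relation E_{Z₀}. -/
open Filter

/-- The summable equivalence relation `E_{S_r}` on `2^ℕ` (subsets of `ℕ` identified
with characteristic functions): `x ∼ y` iff `∑_{n ∈ x Δ y} r n < ∞`. -/
def EsumRel (r : ℕ → ℝ) (x y : ℕ → Bool) : Prop :=
  Summable (fun n : ℕ => if x n = y n then (0 : ℝ) else r n)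

/-- The density-zero equivalence relation `E_{Z₀}` on `2^ℕ`: `x ∼ y` iff the
symmetric difference `x Δ y` has asymptotic density zero. -/
def EZ0 (x y : ℕ → Bool) : Prop :=
  Tendsto (fun n : ℕ =>
      (((Finset.range n).filter (fun m => x m ≠ y m)).card : ℝ) / (n : ℝ))
    atTop (nhds 0)

open PiNat Topology

/-- Negate the bits of `z` at the positions in the finite set `b`. -/
def flipOn (b : Finset ℕ) (z : ℕ → Bool) : ℕ → Bool :=
  fun i => if i ∈ b then !z i else z i

lemma flipOn_flipOn (b : Finset ℕ) (z : ℕ → Bool) : flipOn b (flipOn b z) = z := by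
  funext i
  by_cases h : i ∈ b <;> simp [flipOn, h]

lemma flipOn_union {a b : Finset ℕ} (h : Disjoint b a) (z : ℕ → Bool) :
    flipOn (b ∪ a) z = flipOn b (flipOn a z) := by
  funext i
  by_cases hb : i ∈ b
  · simp [flipOn, hb, Finset.disjoint_left.1 h hb]
  · simp [flipOn, hb]

lemma flipOn_apply_of_notMem {b : Finset ℕ} {i : ℕ} (h : i ∉ b) (z : ℕ → Bool) :
    flipOn b z i = z i := by
  simp [flipOn, h]

lemma ne_flipOn_iff (b : Finset ℕ) (z : ℕ → Bool) (i : ℕ) : z i ≠ flipOn b z i ↔ i ∈ b := by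
  by_cases h : i ∈ b <;> simp [flipOn, h]

lemma flipOn_mem_cylinder {b : Finset ℕ} {x z : ℕ → Bool} {l : ℕ} (h : z ∈ cylinder x l) :
    flipOn b z ∈ cylinder (flipOn b x) l := by
  intro i hi
  simp [flipOn, h i hi]

lemma flipOn_mem_cylinder_of_le {a : Finset ℕ} {x z : ℕ → Bool} {l : ℕ} (ha : ∀ i ∈ a, l ≤ i)
    (h : z ∈ cylinder x l) : flipOn a z ∈ cylinder x l := by
  intro i hi
  rw [flipOn_apply_of_notMem (fun hia => absurd (ha i hia) (not_le.2 hi)), h i hi]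

lemma continuous_flipOn (b : Finset ℕ) : Continuous (flipOn b) := by
  refine continuous_pi fun i => ?_
  by_cases h : i ∈ b
  · simpa only [flipOn, h, if_true, Function.comp_def] using
      (continuous_of_discreteTopology (f := not)).comp (continuous_apply i)
  · simpa [flipOn, h] using continuous_apply i

lemma isOpenMap_flipOn (b : Finset ℕ) : IsOpenMap (flipOn b) :=
  (Homeomorph.mk ⟨flipOn b, flipOn b, flipOn_flipOn b, flipOn_flipOn b⟩
    (continuous_flipOn b) (continuous_flipOn b)).isOpenMap

lemma exists_cylinder_subset {U : Set (ℕ → Bool)} (hU : IsOpen U) {x : ℕ → Bool} (hx : x ∈ U) :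
    ∃ l, cylinder x l ⊆ U := by
  obtain ⟨_, ⟨y, n, rfl⟩, hxy, hsub⟩ :=
    (isTopologicalBasis_cylinders (fun _ : ℕ => Bool)).exists_subset_of_mem_open hx hU
  exact ⟨n, by rwa [mem_cylinder_iff_eq.1 hxy]⟩

/-- Dependent choice along `ℕ`. -/
lemma exists_seq_of_step {α : Type*} {P : ℕ → α → Prop} {R : ℕ → α → α → Prop} {a : α}
    (h0 : P 0 a) (hstep : ∀ k x, P k x → ∃ y, P (k + 1) y ∧ R k x y) :
    ∃ s : ℕ → α, s 0 = a ∧ ∀ k, P k (s k) ∧ R k (s k) (s (k + 1)) := by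
  choose f hf using hstep
  let s : ∀ k, {x // P k x} := fun k =>
    Nat.rec (motive := fun k => {x // P k x}) ⟨a, h0⟩
      (fun k x => ⟨f k x.1 x.2, (hf k x.1 x.2).1⟩) k
  exact ⟨fun k => (s k).1, rfl, fun k => ⟨(s k).2, (hf k (s k).1 (s k).2).2⟩⟩

/-- A sequence of pseudometrics `e n`, locally constant on a comeagre set `C` that is closed under
finite changes (with `C` containing the intersection of the dense open sets `W k`), such that
points differing at finitely many positions have `e n`-distance tending to `0`. -/
structure GenericPseudometrics (e : ℕ → (ℕ → Bool) → (ℕ → Bool) → ℝ) (C : Set (ℕ → Bool))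
    (W : ℕ → Set (ℕ → Bool)) : Prop where
  symm : ∀ n x y, e n x y = e n y x
  triangle : ∀ n x y z, e n x z ≤ e n x y + e n y z
  isOpen : ∀ k, IsOpen (W k)
  dense : ∀ k, Dense (W k)
  iInter_subset : ⋂ k, W k ⊆ C
  flipOn_mem : ∀ b, ∀ x ∈ C, flipOn b x ∈ C
  locConst : ∀ N, ∀ x ∈ C, ∀ y ∈ C, ∃ L, ∀ x' ∈ C, ∀ y' ∈ C, x' ∈ cylinder x L →
    y' ∈ cylinder y L → ∀ n < N, e n x' y' = e n x y
  tendsto_flipOn : ∀ x b, Tendsto (fun n => e n x (flipOn b x)) atTop (𝓝 0)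

/-- A finite approximation to a pair of points: the first point starts with the first `len` bits
of `pt`, the second differs from it below `len` exactly on `diff`. The index `idx` records up to
where the distances of the pair have been taken care of. -/
structure Stage where
  pt : ℕ → Bool
  diff : Finset ℕ
  len : ℕ
  idx : ℕ
  lt_len : ∀ i ∈ diff, i < len

namespace Stage

/-- Candidates for the first point. -/
def fst (σ : Stage) : Set (ℕ → Bool) := cylinder σ.pt σ.len

/-- Candidates for the second point. -/
def snd (σ : Stage) : Set (ℕ → Bool) := cylinder (flipOn σ.diff σ.pt) σ.len

instance : Preorder Stage where
  le σ τ := τ.pt ∈ σ.fst ∧ σ.len ≤ τ.len ∧ σ.idx ≤ τ.idx ∧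
    ∀ i < σ.len, i ∈ τ.diff ↔ i ∈ σ.diff
  le_refl σ := ⟨self_mem_cylinder _ _, le_rfl, le_rfl, fun _ _ => Iff.rfl⟩
  le_trans σ τ υ h h' := ⟨fun i hi => (h'.1 i (hi.trans_le h.2.1)).trans (h.1 i hi),
    h.2.1.trans h'.2.1, h.2.2.1.trans h'.2.2.1,
    fun i hi => (h'.2.2.2 i (hi.trans_le h.2.1)).trans (h.2.2.2 i hi)⟩

variable {σ τ : Stage}

lemma fst_subset (h : σ ≤ τ) : τ.fst ⊆ σ.fst :=
  fun _ hz i hi => (hz i (hi.trans_le h.2.1)).trans (h.1 i hi)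

lemma snd_subset (h : σ ≤ τ) : τ.snd ⊆ σ.snd := by
  intro z hz i hi
  have h1 := h.1 i hi
  have h2 := h.2.2.2 i hi
  rw [hz i (hi.trans_le h.2.1)]
  simp only [flipOn, h1, h2]

lemma flipOn_mem_snd {z : ℕ → Bool} (h : z ∈ σ.fst) : flipOn σ.diff z ∈ σ.snd :=
  flipOn_mem_cylinder h

lemma disjoint_diff {a : Finset ℕ} (ha : ∀ i ∈ a, σ.len ≤ i) : Disjoint σ.diff a :=
  Finset.disjoint_left.2 fun i hi hia => absurd (ha i hia) (not_le.2 (σ.lt_len i hi))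

lemma ne_iff {x y : ℕ → Bool} (hx : x ∈ σ.fst) (hy : y ∈ σ.snd) {i : ℕ} (hi : i < σ.len) :
    x i ≠ y i ↔ i ∈ σ.diff := by
  rw [hx i hi, hy i hi, ne_flipOn_iff]

lemma sum_range_len (r : ℕ → ℝ) {x y : ℕ → Bool} (hx : x ∈ σ.fst) (hy : y ∈ σ.snd) :
    ∑ i ∈ Finset.range σ.len, (if x i = y i then (0 : ℝ) else r i) = ∑ i ∈ σ.diff, r i := by
  have h : ∀ i ∈ Finset.range σ.len,
      (if x i = y i then (0 : ℝ) else r i) = if i ∈ σ.diff then r i else 0 := by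
    intro i hi
    have := ne_iff hx hy (Finset.mem_range.1 hi)
    by_cases hxy : x i = y i <;> simp_all
  rw [Finset.sum_congr rfl h, ← Finset.sum_filter]
  congr 1
  ext i
  simpa using σ.lt_len i

/-- Extend a stage by flipping a further finite set `a` beyond `σ.len`, following `z` up to at
least `L`. -/
def extend (σ : Stage) (z : ℕ → Bool) (a : Finset ℕ) (L : ℕ) : Stage where
  pt := z
  diff := σ.diff ∪ a
  len := max (max σ.len L) (a.sup id + 1)
  idx := σ.idx
  lt_len i hi := by
    rcases Finset.mem_union.1 hi with hi | hi
    · exact lt_max_of_lt_left (lt_max_of_lt_left (σ.lt_len i hi))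
    · exact lt_max_of_lt_right (Nat.lt_succ_of_le (Finset.le_sup (f := id) hi))

lemma le_extend {z : ℕ → Bool} {a : Finset ℕ} (hz : z ∈ σ.fst) (ha : ∀ i ∈ a, σ.len ≤ i) (L : ℕ) :
    σ ≤ σ.extend z a L := by
  refine ⟨hz, (le_max_left _ _).trans (le_max_left _ _), le_rfl, fun i hi => ?_⟩
  have : i ∉ a := fun hia => absurd (ha i hia) (not_le.2 hi)
  simp [extend, this]

lemma le_len_extend (z : ℕ → Bool) (a : Finset ℕ) (L : ℕ) : L ≤ (σ.extend z a L).len :=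
  (le_max_right _ _).trans (le_max_left _ _)

lemma sum_diff_extend (r : ℕ → ℝ) {z : ℕ → Bool} {a : Finset ℕ} (ha : ∀ i ∈ a, σ.len ≤ i) (L : ℕ) :
    ∑ i ∈ (σ.extend z a L).diff, r i = ∑ i ∈ σ.diff, r i + ∑ i ∈ a, r i :=
  Finset.sum_union (disjoint_diff ha)

/-- On generic points of `σ`, the flip by `σ.diff` has effect at most `ε` from `σ.idx` on. -/
def Settled (e : ℕ → (ℕ → Bool) → (ℕ → Bool) → ℝ) (C : Set (ℕ → Bool)) (σ : Stage) (ε : ℝ) :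
    Prop :=
  ∀ z ∈ C, z ∈ σ.fst → ∀ n, σ.idx ≤ n → e n z (flipOn σ.diff z) ≤ ε

/-- All candidates for either point lie in `V`. -/
def Meets (σ : Stage) (V : Set (ℕ → Bool)) : Prop := σ.fst ⊆ V ∧ σ.snd ⊆ V

lemma Meets.mono {V : Set (ℕ → Bool)} (h : σ.Meets V) (hle : σ ≤ τ) : τ.Meets V :=
  ⟨(fst_subset hle).trans h.1, (snd_subset hle).trans h.2⟩

end Stage

open Stage

lemma exists_limit {W : ℕ → Set (ℕ → Bool)} {s : ℕ → Stage} (hle : ∀ k, s k ≤ s (k + 1))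
    (hlen : ∀ k, k ≤ (s k).len) (hW : ∀ k, (s (k + 1)).Meets (W k)) :
    ∃ x ∈ ⋂ k, W k, ∃ y ∈ ⋂ k, W k, ∀ k, x ∈ (s k).fst ∧ y ∈ (s k).snd := by
  have hmono : Monotone s := monotone_nat_of_le_succ hle
  have key : ∀ k i, i < (s k).len →
      (s (i + 1)).pt i = (s k).pt i ∧ (i ∈ (s (i + 1)).diff ↔ i ∈ (s k).diff) := by
    intro k i hi
    rcases le_total k (i + 1) with h | h
    · exact ⟨(hmono h).1 i hi, (hmono h).2.2.2 i hi⟩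
    · exact ⟨((hmono h).1 i (hlen (i + 1))).symm, ((hmono h).2.2.2 i (hlen (i + 1))).symm⟩
  let x : ℕ → Bool := fun i => (s (i + 1)).pt i
  let y : ℕ → Bool := fun i => flipOn (s (i + 1)).diff (s (i + 1)).pt i
  have hx : ∀ k, x ∈ (s k).fst := fun k i hi => (key k i hi).1
  have hy : ∀ k, y ∈ (s k).snd := by
    intro k i hi
    simp only [y, flipOn, (key k i hi).1, (key k i hi).2]
  exact ⟨x, Set.mem_iInter.2 fun k => (hW k).1 (hx _), y, Set.mem_iInter.2 fun k => (hW k).2 (hy _),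
    fun k => ⟨hx k, hy k⟩⟩

namespace GenericPseudometrics

variable {e : ℕ → (ℕ → Bool) → (ℕ → Bool) → ℝ} {C : Set (ℕ → Bool)} {W : ℕ → Set (ℕ → Bool)}

lemma exists_settled (h : GenericPseudometrics e C W) (σ : Stage) {ε : ℝ} (hε : 0 < ε)
    (k N : ℕ) :
    ∃ τ, σ ≤ τ ∧ τ.diff = σ.diff ∧ k < τ.len ∧ N ≤ τ.idx ∧ τ.Settled e C ε ∧ τ.Meets (W k) ∧
      τ.pt ∈ C ∧ ∀ z ∈ C, ∀ w ∈ C, z ∈ τ.fst → w ∈ τ.snd → ∀ n < τ.idx,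
        e n z w = e n τ.pt (flipOn τ.diff τ.pt) := by
  let b := σ.diff
  let F : ℕ → Set (ℕ → Bool) := fun m => {x | x ∈ C ∧ ∀ n, m ≤ n → e n x (flipOn b x) ≤ ε}
  have hdense : Dense (⋂ k, W k) := dense_iInter_of_isOpen h.isOpen h.dense
  have hcov : ⋂ k, W k ⊆ ⋃ m, closure (F m) := by
    intro x hx
    obtain ⟨m, hm⟩ := eventually_atTop.1 ((h.tendsto_flipOn x b).eventually (ge_mem_nhds hε))
    exact Set.mem_iUnion.2 ⟨m, subset_closure ⟨h.iInter_subset hx, hm⟩⟩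
  have hint : Dense (⋃ m, interior (closure (F m))) :=
    (IsGδ.iInter_of_isOpen h.isOpen).dense_iUnion_interior_of_closed hdense
      (fun _ => isClosed_closure) hcov
  have hV : IsOpen (W k ∩ flipOn b ⁻¹' W k) :=
    (h.isOpen k).inter ((h.isOpen k).preimage (continuous_flipOn b))
  have hVd : Dense (W k ∩ flipOn b ⁻¹' W k) :=
    (h.dense k).inter_of_isOpen_left ((h.dense k).preimage (isOpenMap_flipOn b)) (h.isOpen k)
  obtain ⟨p, hpσ, hpV, hpi⟩ := (hVd.inter_of_isOpen_left hint hV).inter_open_nonempty σ.fst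
    (isOpen_cylinder _ _ _) ⟨σ.pt, self_mem_cylinder _ _⟩
  obtain ⟨m, hpm⟩ := Set.mem_iUnion.1 hpi
  obtain ⟨q, ⟨hqσ, hqV, hqm⟩, hqC⟩ := hdense.inter_open_nonempty
    (σ.fst ∩ ((W k ∩ flipOn b ⁻¹' W k) ∩ interior (closure (F m))))
    ((isOpen_cylinder _ _ _).inter (hV.inter isOpen_interior)) ⟨p, hpσ, hpV, hpm⟩
  replace hqC := h.iInter_subset hqC
  obtain ⟨l, hl⟩ := exists_cylinder_subset (hV.inter isOpen_interior) ⟨hqV, hqm⟩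
  obtain ⟨L, hL⟩ := h.locConst (max (max m N) σ.idx) q hqC (flipOn b q) (h.flipOn_mem b q hqC)
  let len := max (max l L) (max σ.len (k + 1))
  have h1 : l ≤ len := (le_max_left _ _).trans (le_max_left _ _)
  have h2 : L ≤ len := (le_max_right _ _).trans (le_max_left _ _)
  have h3 : σ.len ≤ len := (le_max_left _ _).trans (le_max_right _ _)
  have h4 : k + 1 ≤ len := (le_max_right _ _).trans (le_max_right _ _)
  refine ⟨⟨q, b, len, max (max m N) σ.idx, fun i hi => (σ.lt_len i hi).trans_le h3⟩,
    ⟨hqσ, h3, le_max_right _ _, fun _ _ => Iff.rfl⟩, rfl, h4,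
    (le_max_right _ _).trans (le_max_left _ _), ?_, ⟨?_, ?_⟩, hqC, ?_⟩
  · intro z hzC hz n hn
    obtain ⟨M, hM⟩ := h.locConst (n + 1) z hzC (flipOn b z) (h.flipOn_mem b z hzC)
    have hzF : z ∈ closure (F m) := interior_subset (hl (cylinder_anti _ h1 hz)).2
    obtain ⟨w, hwz, hwC, hw⟩ := mem_closure_iff.1 hzF _ (isOpen_cylinder _ z M)
      (self_mem_cylinder z M)
    change e n z (flipOn b z) ≤ ε
    rw [← hM w hwC _ (h.flipOn_mem b w hwC) hwz (flipOn_mem_cylinder hwz) n n.lt_succ_self]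
    exact hw n (((le_max_left _ _).trans (le_max_left _ _)).trans hn)
  · exact fun z hz => (hl (cylinder_anti _ h1 hz)).1.1
  · intro z hz
    have : flipOn b z ∈ cylinder q len := by
      simpa only [flipOn_flipOn] using flipOn_mem_cylinder (b := b) hz
    simpa only [Set.mem_preimage, flipOn_flipOn] using (hl (cylinder_anti _ h1 this)).1.2
  · exact fun z hzC w hwC hz hw n hn =>
      hL z hzC w hwC (cylinder_anti _ h2 hz) (cylinder_anti _ h2 hw) n hn

/-- If points with summable difference have `e n`-distance tending to `0`, then small changes of
generic points have uniformly small effect. -/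
lemma exists_small_effect (h : GenericPseudometrics e C W) {r : ℕ → ℝ} (hr0 : ∀ n, 0 ≤ r n)
    (hred : ∀ x ∈ C, ∀ y ∈ C, EsumRel r x y → Tendsto (fun n => e n x y) atTop (𝓝 0))
    {ε : ℝ} (hε : 0 < ε) (σ : Stage) :
    ∃ x ∈ σ.fst, ∃ l, ∃ δ > 0, ∃ m, ∀ z ∈ C, z ∈ cylinder x l → z ∈ σ.fst →
      ∀ a : Finset ℕ, (∀ i ∈ a, l ≤ i) → (∀ i ∈ a, σ.len ≤ i) → ∑ i ∈ a, r i < δ →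
        ∀ n, m ≤ n → e n z (flipOn a z) ≤ ε := by
  by_contra! hcon
  obtain ⟨σ₀, hσ₀, -, -, -, hset₀, -⟩ := h.exists_settled σ (half_pos hε) 0 0
  obtain ⟨s, -, hs⟩ := exists_seq_of_step
    (P := fun k τ => σ ≤ τ ∧ k ≤ τ.len ∧ k ≤ τ.idx ∧ τ.Settled e C (ε / 2))
    (R := fun k τ υ => τ ≤ υ ∧ υ.Meets (W k) ∧
      ∑ i ∈ υ.diff, r i ≤ ∑ i ∈ τ.diff, r i + (1 / 2 : ℝ) ^ k ∧
      ∃ n, τ.idx ≤ n ∧ ∀ z ∈ C, ∀ w ∈ C, z ∈ υ.fst → w ∈ υ.snd → ε / 2 ≤ e n z w)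
    (a := σ₀) ⟨hσ₀, Nat.zero_le _, Nat.zero_le _, hset₀⟩ (by
      rintro k τ ⟨hστ, hkl, hki, hτ⟩
      obtain ⟨z, hzC, hzτ, -, a, ha, -, har, n, hn, hlt⟩ := hcon τ.pt
        (fst_subset hστ (self_mem_cylinder _ _)) τ.len ((1 / 2 : ℝ) ^ k) (by positivity) τ.idx
      obtain ⟨L, hL⟩ := h.locConst (n + 1) z hzC (flipOn (τ.diff ∪ a) z) (h.flipOn_mem _ z hzC)
      have hle := le_extend (σ := τ) hzτ ha L
      obtain ⟨υ, hυ, hdiff, hlen, hidx, hset, hmeet, -⟩ :=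
        h.exists_settled (τ.extend z a L) (half_pos hε) k (k + 1)
      refine ⟨υ, ⟨hστ.trans (hle.trans hυ), hlen, hidx, hset⟩, hle.trans hυ, hmeet, ?_, n, hn, ?_⟩
      · rw [hdiff, sum_diff_extend r ha]
        linarith
      · intro x hxC y hyC hx hy
        have hx' : x ∈ cylinder z L := cylinder_anti _ (le_len_extend z a L) (fst_subset hυ hx)
        have hy' : y ∈ cylinder (flipOn (τ.diff ∪ a) z) L :=
          cylinder_anti _ (le_len_extend z a L) (snd_subset hυ hy)
        rw [hL x hxC y hyC hx' hy' n n.lt_succ_self]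
        have h1 := h.triangle n z (flipOn (τ.diff ∪ a) z) (flipOn a z)
        have h2 := hτ (flipOn a z) (h.flipOn_mem a z hzC) (flipOn_mem_cylinder_of_le ha hzτ) n hn
        rw [h.symm, ← flipOn_union (disjoint_diff ha)] at h2
        linarith)
  obtain ⟨x, hx, y, hy, hxy⟩ := exists_limit (fun k => (hs k).2.1) (fun k => (hs k).1.2.1)
    (fun k => (hs k).2.2.1)
  have hsum : ∀ k, ∑ i ∈ (s k).diff, r i ≤ ∑ i ∈ (s 0).diff, r i + (2 - 2 * (1 / 2 : ℝ) ^ k) := by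
    intro k
    induction k with
    | zero => simp
    | succ k ih =>
      have := (hs k).2.2.2.1
      rw [pow_succ]
      linarith
  have hsummable : EsumRel r x y := by
    have hf : ∀ i, 0 ≤ if x i = y i then (0 : ℝ) else r i := by
      intro i
      split_ifs
      exacts [le_rfl, hr0 i]
    refine summable_of_sum_range_le hf (c := ∑ i ∈ (s 0).diff, r i + 2) fun k => ?_
    calc _ ≤ ∑ i ∈ Finset.range (s k).len, (if x i = y i then (0 : ℝ) else r i) :=
          Finset.sum_le_sum_of_subset_of_nonneg (Finset.range_mono (hs k).1.2.1) fun i _ _ => hf i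
      _ = ∑ i ∈ (s k).diff, r i := sum_range_len r (hxy k).1 (hxy k).2
      _ ≤ _ := by
        have := hsum k
        have : (0 : ℝ) ≤ (1 / 2 : ℝ) ^ k := by positivity
        linarith
  have hxC := h.iInter_subset hx
  have hyC := h.iInter_subset hy
  obtain ⟨N, hN⟩ := eventually_atTop.1
    ((hred x hxC y hyC hsummable).eventually (gt_mem_nhds (half_pos hε)))
  obtain ⟨n, hn, hne⟩ := (hs N).2.2.2.2
  exact absurd (hN n ((hs N).1.2.2.1.trans hn))
    (not_lt.2 (hne x hxC y hyC (hxy _).1 (hxy _).2))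

end GenericPseudometrics

lemma exists_block {r : ℕ → ℝ} (hr0 : ∀ n, 0 ≤ r n) (hrlim : Tendsto r atTop (𝓝 0))
    (hrdiv : ¬ Summable r) {δ : ℝ} (hδ : 0 < δ) (l : ℕ) :
    ∃ a : Finset ℕ, (∀ i ∈ a, l ≤ i) ∧ δ / 2 ≤ ∑ i ∈ a, r i ∧ ∑ i ∈ a, r i < δ := by
  obtain ⟨L, hL⟩ := eventually_atTop.1 (hrlim.eventually (gt_mem_nhds (half_pos hδ)))
  let M := max l L
  have hex : ∃ n, δ / 2 ≤ ∑ i ∈ Finset.range n, r (i + M) := by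
    by_contra! hcon
    exact hrdiv ((summable_nat_add_iff M).1
      (summable_of_sum_range_le (fun _ => hr0 _) fun n => (hcon n).le))
  classical
  have hspec := Nat.find_spec hex
  have hmin := fun m => Nat.find_min hex (m := m)
  revert hspec hmin
  generalize Nat.find hex = n
  intro hspec hmin
  refine ⟨(Finset.range n).map (addRightEmbedding M), ?_, ?_, ?_⟩
  · simp only [Finset.mem_map, addRightEmbedding_apply]
    rintro _ ⟨i, -, rfl⟩
    exact (le_max_left l L).trans (Nat.le_add_left _ _)
  · simpa using hspec
  · simp only [Finset.sum_map, addRightEmbedding_apply]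
    cases n with
    | zero => simpa using hδ
    | succ n =>
      have h1 := not_le.1 (hmin n n.lt_succ_self)
      have h2 := hL (n + M) ((le_max_right l L).trans (Nat.le_add_left _ _))
      rw [Finset.sum_range_succ]
      linarith

namespace GenericPseudometrics

variable {e : ℕ → (ℕ → Bool) → (ℕ → Bool) → ℝ} {C : Set (ℕ → Bool)} {W : ℕ → Set (ℕ → Bool)}

lemma exists_large_difference (h : GenericPseudometrics e C W) {r : ℕ → ℝ} (hr0 : ∀ n, 0 ≤ r n)
    (hrlim : Tendsto r atTop (𝓝 0)) (hrdiv : ¬ Summable r)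
    (hred : ∀ x ∈ C, ∀ y ∈ C, EsumRel r x y → Tendsto (fun n => e n x y) atTop (𝓝 0))
    {ε η : ℝ} (hε : 0 < ε) (hη : 0 ≤ η) {σ : Stage} (hσ : σ.Settled e C η) (k : ℕ) :
    ∃ τ, σ ≤ τ ∧ k < τ.len ∧ k < τ.idx ∧ τ.Settled e C ε ∧ τ.Meets (W k) ∧
      1 + ∑ i ∈ σ.diff, r i ≤ ∑ i ∈ τ.diff, r i ∧
      ∀ z ∈ C, ∀ w ∈ C, z ∈ τ.fst → w ∈ τ.snd → ∀ n, σ.idx ≤ n → n < τ.idx →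
        e n z w ≤ η + 2 * ε := by
  obtain ⟨x, hx, l, δ, hδ, m, hsmall⟩ := h.exists_small_effect hr0 hred hε σ
  have hle₁ : σ ≤ σ.extend x ∅ l := le_extend hx (by simp) l
  obtain ⟨τ₀, hle₀, hdiff₀, hlen₀, hidx₀, hset₀, hmeet₀, hC₀, hdec₀⟩ :=
    h.exists_settled (σ.extend x ∅ l) hε k (max m (k + 1))
  have hστ₀ := hle₁.trans hle₀
  have hl₀ : l ≤ τ₀.len := (le_len_extend x ∅ l).trans hle₀.2.1
  have key : ∀ j : ℕ, ∃ τ, τ₀ ≤ τ ∧ τ.Settled e C ε ∧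
      j * (δ / 2) + ∑ i ∈ σ.diff, r i ≤ ∑ i ∈ τ.diff, r i ∧
      ∀ z ∈ C, ∀ w ∈ C, z ∈ τ.fst → w ∈ τ.snd → ∀ n, σ.idx ≤ n → n < τ.idx →
        e n z w ≤ η + 2 * ε := by
    intro j
    induction j with
    | zero =>
      refine ⟨τ₀, le_rfl, hset₀, ?_, fun z hz w hw hzτ hwτ n hn hn' => ?_⟩
      · rw [hdiff₀, sum_diff_extend r (by simp)]
        simp
      · rw [hdec₀ z hz w hw hzτ hwτ n hn', hdiff₀]
        have := hσ τ₀.pt hC₀ hστ₀.1 n hn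
        simp only [extend, Finset.union_empty]
        linarith
    | succ j ih =>
      obtain ⟨τ, hτ₀, hset, hmass, hbound⟩ := ih
      obtain ⟨a, ha, har, har'⟩ := exists_block hr0 hrlim hrdiv hδ τ.len
      have hle := le_extend (σ := τ) (self_mem_cylinder _ _) ha 0
      obtain ⟨υ, hυ, hdiff, -, -, hsetυ, -, hυC, hdec⟩ :=
        h.exists_settled (τ.extend τ.pt a 0) hε 0 0
      have hτυ := hle.trans hυ
      refine ⟨υ, hτ₀.trans hτυ, hsetυ, ?_, fun z hz w hw hzυ hwυ n hn hn' => ?_⟩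
      · rw [hdiff, sum_diff_extend r ha]
        push_cast
        linarith
      · rcases lt_or_ge n τ.idx with hnτ | hnτ
        · exact hbound z hz w hw (fst_subset hτυ hzυ) (snd_subset hτυ hwυ) n hn hnτ
        · rw [hdec z hz w hw hzυ hwυ n hn', hdiff]
          change e n υ.pt (flipOn (τ.diff ∪ a) υ.pt) ≤ _
          rw [flipOn_union (disjoint_diff ha)]
          have hυτ : υ.pt ∈ τ.fst := hτυ.1
          have h1 := h.triangle n υ.pt (flipOn a υ.pt) (flipOn τ.diff (flipOn a υ.pt))
          have h2 := hset (flipOn a υ.pt) (h.flipOn_mem a _ hυC)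
            (flipOn_mem_cylinder_of_le ha hυτ) n hnτ
          have hx₁ := fst_subset hle₀ (fst_subset hτ₀ hυτ)
          have h3 := hsmall υ.pt hυC (cylinder_anti _ (le_len_extend x ∅ l) hx₁)
            (fst_subset hle₁ hx₁) a
            (fun i hi => (hl₀.trans hτ₀.2.1).trans (ha i hi))
            (fun i hi => ((hστ₀.trans hτ₀).2.1).trans (ha i hi)) har' n
            (((le_max_left _ _).trans hidx₀).trans (hτ₀.2.2.1.trans hnτ))
          linarith
  obtain ⟨j, hj⟩ := exists_nat_ge (1 / (δ / 2))
  obtain ⟨τ, hτ₀, hset, hmass, hbound⟩ := key j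
  refine ⟨τ, hστ₀.trans hτ₀, hlen₀.trans_le hτ₀.2.1,
    ((le_max_right _ _).trans hidx₀).trans hτ₀.2.2.1, hset, hmeet₀.mono hτ₀, ?_, hbound⟩
  have := (div_le_iff₀ (half_pos hδ)).1 hj
  linarith

/-- Some pair of points with non-summable difference has `e n`-distance tending to `0`. -/
lemma exists_tendsto_of_not_esumRel (h : GenericPseudometrics e C W) {r : ℕ → ℝ}
    (hr0 : ∀ n, 0 ≤ r n) (hrlim : Tendsto r atTop (𝓝 0)) (hrdiv : ¬ Summable r)
    (hnonneg : ∀ n x y, 0 ≤ e n x y)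
    (hred : ∀ x ∈ C, ∀ y ∈ C, EsumRel r x y → Tendsto (fun n => e n x y) atTop (𝓝 0)) :
    ∃ x y, ¬ EsumRel r x y ∧ Tendsto (fun n => e n x y) atTop (𝓝 0) := by
  obtain ⟨σ₀, -, -, -, -, hset₀, -⟩ :=
    h.exists_settled ⟨fun _ => false, ∅, 0, 0, by simp⟩ one_pos 0 0
  obtain ⟨s, -, hs⟩ := exists_seq_of_step
    (P := fun k τ => k ≤ τ.len ∧ k ≤ τ.idx ∧ τ.Settled e C ((1 / 2 : ℝ) ^ k))
    (R := fun k τ υ => τ ≤ υ ∧ υ.Meets (W k) ∧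
      1 + ∑ i ∈ τ.diff, r i ≤ ∑ i ∈ υ.diff, r i ∧
      ∀ z ∈ C, ∀ w ∈ C, z ∈ υ.fst → w ∈ υ.snd → ∀ n, τ.idx ≤ n → n < υ.idx →
        e n z w ≤ (1 / 2 : ℝ) ^ k + 2 * (1 / 2 : ℝ) ^ (k + 1))
    (a := σ₀) ⟨Nat.zero_le _, Nat.zero_le _, by simpa using hset₀⟩ (by
      rintro k τ ⟨-, -, hτ⟩
      obtain ⟨υ, h1, h2, h3, h4, h5, h6, h7⟩ := h.exists_large_difference hr0 hrlim hrdiv hred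
        (ε := (1 / 2 : ℝ) ^ (k + 1)) (by positivity) (by positivity) hτ k
      exact ⟨υ, ⟨h2, h3, h4⟩, h1, h5, h6, h7⟩)
  obtain ⟨x, hx, y, hy, hxy⟩ := exists_limit (fun k => (hs k).2.1) (fun k => (hs k).1.1)
    (fun k => (hs k).2.2.1)
  have hxC := h.iInter_subset hx
  have hyC := h.iInter_subset hy
  refine ⟨x, y, fun hsum => ?_, ?_⟩
  · have hmass : ∀ k : ℕ, (k : ℝ) ≤ ∑ i ∈ (s k).diff, r i := by
      intro k
      induction k with
      | zero => simpa using Finset.sum_nonneg fun i _ => hr0 i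
      | succ k ih =>
        have := (hs k).2.2.2.1
        push_cast
        linarith
    obtain ⟨k, hk⟩ := exists_nat_gt (∑' i, if x i = y i then (0 : ℝ) else r i)
    have h1 := Summable.sum_le_tsum (Finset.range (s k).len) (fun i _ => by
      split_ifs
      exacts [le_rfl, hr0 i]) hsum
    rw [sum_range_len r (hxy k).1 (hxy k).2] at h1
    linarith [hmass k]
  · have hmono : Monotone s := monotone_nat_of_le_succ fun k => (hs k).2.1
    have hblock : ∀ K j n, (s K).idx ≤ n → n < (s (K + j)).idx →
        e n x y ≤ 2 * (1 / 2 : ℝ) ^ K := by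
      intro K j n hK hn
      induction j with
      | zero => exact absurd hK (not_le.2 hn)
      | succ j ih =>
        rcases lt_or_ge n (s (K + j)).idx with hlt | hge
        · exact ih hlt
        · have h1 := (hs (K + j)).2.2.2.2 x hxC y hyC (hxy _).1 (hxy _).2 n hge hn
          have h2 : (1 / 2 : ℝ) ^ (K + j) ≤ (1 / 2 : ℝ) ^ K :=
            pow_le_pow_of_le_one (by norm_num) (by norm_num) (Nat.le_add_right _ _)
          rw [pow_succ] at h1
          linarith
    rw [Metric.tendsto_atTop]
    intro ε hε
    obtain ⟨K, hK⟩ := exists_pow_lt_of_lt_one (half_pos hε) (by norm_num : (1 / 2 : ℝ) < 1)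
    refine ⟨(s K).idx, fun n hn => ?_⟩
    have hlt : n < (s (K + (n + 1))).idx :=
      lt_of_lt_of_le (by omega) (hs (K + (n + 1))).1.2.1
    rw [Real.dist_eq, sub_zero, abs_of_nonneg (hnonneg n x y)]
    linarith [hblock K (n + 1) n hn hlt]

end GenericPseudometrics

/-- The fraction of positions below `n` at which `u` and `v` differ. -/
noncomputable def diffDensity (n : ℕ) (u v : ℕ → Bool) : ℝ :=
  (((Finset.range n).filter (fun m => u m ≠ v m)).card : ℝ) / (n : ℝ)

lemma diffDensity_nonneg (n : ℕ) (u v : ℕ → Bool) : 0 ≤ diffDensity n u v := by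
  unfold diffDensity
  positivity

lemma diffDensity_comm (n : ℕ) (u v : ℕ → Bool) : diffDensity n u v = diffDensity n v u := by
  simp only [diffDensity, ne_comm]

lemma diffDensity_triangle (n : ℕ) (u v w : ℕ → Bool) :
    diffDensity n u w ≤ diffDensity n u v + diffDensity n v w := by
  unfold diffDensity
  rw [← add_div]
  gcongr
  norm_cast
  refine (Finset.card_le_card fun m hm => ?_).trans (Finset.card_union_le _ _)
  simp only [Finset.mem_union, Finset.mem_filter] at hm ⊢
  by_cases h : u m = v m
  · exact Or.inr ⟨hm.1, h ▸ hm.2⟩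
  · exact Or.inl ⟨hm.1, h⟩

lemma diffDensity_congr {n : ℕ} {u v u' v' : ℕ → Bool} (hu : ∀ m < n, u' m = u m)
    (hv : ∀ m < n, v' m = v m) : diffDensity n u' v' = diffDensity n u v := by
  unfold diffDensity
  congr 3
  refine Finset.filter_congr fun m hm => ?_
  rw [hu m (Finset.mem_range.1 hm), hv m (Finset.mem_range.1 hm)]

/-- A Borel map on Cantor space is continuous on a comeagre set closed under finite changes. -/
lemma exists_residual_locallyConst {θ : (ℕ → Bool) → ℕ → Bool}
    (hθ : @Measurable _ _ (borel (ℕ → Bool)) (borel (ℕ → Bool)) θ) :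
    ∃ C ∈ residual (ℕ → Bool), (∀ b, ∀ x ∈ C, flipOn b x ∈ C) ∧
      ∀ N, ∀ x ∈ C, ∃ L, ∀ x' ∈ C, x' ∈ cylinder x L → ∀ m < N, θ x' m = θ x m := by
  have hopen : ∀ p : ℕ × Bool, ∃ U : Set (ℕ → Bool), IsOpen U ∧ {x | θ x p.1 = p.2} =ᵇ U := by
    intro p
    have hcyl : IsOpen {u : ℕ → Bool | u p.1 = p.2} :=
      (isOpen_discrete ({p.2} : Set Bool)).preimage
        (continuous_apply (A := fun _ : ℕ => Bool) p.1)
    let _ : MeasurableSpace (ℕ → Bool) := borel _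
    have : BorelSpace (ℕ → Bool) := ⟨rfl⟩
    exact (hθ hcyl.measurableSet).residualEq_isOpen
  choose U hU hθU using hopen
  let C₀ : Set (ℕ → Bool) := {x | ∀ p : ℕ × Bool, θ x p.1 = p.2 ↔ x ∈ U p}
  have hC₀ : C₀ ∈ residual (ℕ → Bool) :=
    eventually_countable_forall.2 fun p => (eventuallyEq_set.1 (hθU p))
  refine ⟨{x | ∀ b, flipOn b x ∈ C₀}, ?_, ?_, ?_⟩
  · exact eventually_countable_forall.2 fun b =>
      tendsto_residual_of_isOpenMap (continuous_flipOn b) (isOpenMap_flipOn b) hC₀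
  · intro b x hx b'
    have : flipOn b' (flipOn b x) = flipOn (symmDiff b' b) x := by
      funext i
      by_cases h : i ∈ b <;> by_cases h' : i ∈ b' <;> simp [flipOn, Finset.mem_symmDiff, h, h']
    rw [this]
    exact hx _
  · have hsub : ∀ x, (∀ b, flipOn b x ∈ C₀) → x ∈ C₀ := by
      intro x hx
      have h : flipOn ∅ x = x := by
        funext i
        simp [flipOn]
      exact h ▸ hx ∅
    intro N x hx
    have hloc : ∀ m, ∃ L, cylinder x L ⊆ U (m, θ x m) := fun m =>
      exists_cylinder_subset (hU _) ((hsub x hx (m, θ x m)).1 rfl)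
    choose L hL using hloc
    refine ⟨(Finset.range N).sup L, fun x' hx' hmem m hm => ?_⟩
    exact (hsub x' hx' (m, θ x m)).2
      (hL m (cylinder_anti _ (Finset.le_sup (Finset.mem_range.2 hm)) hmem))

/-- Hjorth: if `r : ℕ → ℝ` is nonnegative, tends to `0`, and
`∑ₙ r n = ∞`, then the summable equivalence relation `E_{S_r}` is not Borel
reducible to the density-zero equivalence relation `E_{Z₀}`. -/
theorem summable_not_reducible_to_density_zero
    (r : ℕ → ℝ) (hr0 : ∀ n, 0 ≤ r n)
    (hrlim : Tendsto r atTop (nhds 0))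
    (hrdiv : ¬ Summable r) :
    ¬ BorelReducible (EsumRel r) EZ0 := by
  rintro ⟨θ, hθ, hred⟩
  obtain ⟨C, hC, hflip, hloc⟩ := exists_residual_locallyConst hθ
  obtain ⟨t, htC, htG, htd⟩ := mem_residual.1 hC
  obtain ⟨W, hW, rfl⟩ := isGδ_iff_eq_iInter_nat.1 htG
  have h : GenericPseudometrics (fun n x y => diffDensity n (θ x) (θ y)) C W :=
    { symm := fun n x y => diffDensity_comm n _ _
      triangle := fun n x y z => diffDensity_triangle n _ _ _
      isOpen := hW
      dense := fun k => htd.mono (Set.iInter_subset W k)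
      iInter_subset := htC
      flipOn_mem := hflip
      locConst := by
        intro N x hx y hy
        obtain ⟨L, hL⟩ := hloc N x hx
        obtain ⟨M, hM⟩ := hloc N y hy
        exact ⟨max L M, fun x' hx' y' hy' hxx hyy n hn => diffDensity_congr
          (fun m hm => hL x' hx' (cylinder_anti _ (le_max_left _ _) hxx) m (hm.trans hn))
          (fun m hm => hM y' hy' (cylinder_anti _ (le_max_right _ _) hyy) m (hm.trans hn))⟩
      tendsto_flipOn := fun x b => (hred x (flipOn b x)).1
        (summable_of_ne_finset_zero (s := b) fun i hi => by simp [flipOn, hi]) }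
  obtain ⟨x, y, hxy, hlim⟩ := h.exists_tendsto_of_not_esumRel hr0 hrlim hrdiv
    (fun n x y => diffDensity_nonneg n _ _) (fun x _ y _ hxy => (hred x y).1 hxy)
  exact hxy ((hred x y).2 hlim)
end
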